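/- arXiv:math/0403502 — 3 statements merged into one kernel-verified Lean document; each statement's English description precedes it below -/
import Mathlib

section
/- The sequence (S_n(12453))^{1/n} converges, as n → ∞, to (1 + √8)² = 9 + 4√2. -/
/-- A permutation `p` of length `n` contains the pattern `q` of length `k`:
there are positions `f 0 < f 1 < … < f (k-1)` whose values are order-isomorphic to `q`. -/
def PermContains {n k : ℕ} (p : Equiv.Perm (Fin n)) (q : Equiv.Perm (Fin k)) : Prop :=
  ∃ f : Fin k → Fin n, StrictMono f ∧ ∀ a b : Fin k, p (f a) < p (f b) ↔ q a < q b

/-- `p` avoids the pattern `q`. -/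
def PermAvoids {n k : ℕ} (p : Equiv.Perm (Fin n)) (q : Equiv.Perm (Fin k)) : Prop :=
  ¬ PermContains p q

/-- `avoiders n q` is `S_n(q)`, the number of permutations of length `n` avoiding `q`. -/
noncomputable def avoiders (n : ℕ) {k : ℕ} (q : Equiv.Perm (Fin k)) : ℕ :=
  Nat.card {p : Equiv.Perm (Fin n) // PermAvoids p q}

/-- The pattern 12453 (0-indexed: 0,1,3,4,2). -/
def pat12453 : Equiv.Perm (Fin 5) :=
  ⟨![0, 1, 3, 4, 2], ![0, 1, 4, 2, 3], by decide, by decide⟩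

section

open Finset

/-- The size of a stack of blocks, where the entry `b` encodes a block with `b + 1` elements. -/
def stackSize : List ℕ → ℕ
  | [] => 0
  | b :: c => b + 1 + stackSize c

/-- Insertion into a stack of blocks at height `i`: if `i` separates two blocks, all blocks above
`i` are merged with the new element; otherwise everything above `i` is discarded and the new
element forms a block of its own. -/
def stackInsert : List ℕ → ℕ → List ℕ
  | [], _ => [0]
  | b :: c, i =>
    if i = 0 then [b + 1 + stackSize c]
    else if i ≤ b then [i - 1, 0] else b :: stackInsert c (i - (b + 1))

/-- The sum of `φ` over all results of an insertion into `c`. -/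
def stackSum (φ : List ℕ → ℝ) (c : List ℕ) : ℝ :=
  ∑ i ∈ range (stackSize c + 1), φ (stackInsert c i)

/-- The sum of `φ` over the results of all sequences of `n` insertions into the empty stack. -/
def stackTotal : ℕ → (List ℕ → ℝ) → ℝ
  | 0, φ => φ []
  | n + 1, φ => stackTotal n (stackSum φ)

theorem stackSum_nil (φ : List ℕ → ℝ) : stackSum φ [] = φ [0] := by
  simp [stackSum, stackSize, stackInsert]

theorem stackSum_cons (φ : List ℕ → ℝ) (b : ℕ) (c : List ℕ) :
    stackSum φ (b :: c) = φ [stackSize (b :: c)] + ∑ j ∈ range b, φ [j, 0] +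
      stackSum (fun c' => φ (b :: c')) c := by
  have h : stackSize (b :: c) + 1 = b + 1 + (stackSize c + 1) := by simp [stackSize]; ring
  rw [stackSum, h, sum_range_add, sum_range_succ', add_comm (∑ _ ∈ _, _)]
  congr 1
  · congr 1
    refine sum_congr rfl fun j hj => ?_
    have := mem_range.1 hj
    simp [stackInsert, Nat.succ_le_of_lt this]
  · refine sum_congr rfl fun j _ => ?_
    have h1 : ¬ b + 1 + j ≤ b := by omega
    simp [stackInsert, h1]

theorem stackTotal_add (n : ℕ) (φ ψ : List ℕ → ℝ) :
    stackTotal n (fun c => φ c + ψ c) = stackTotal n φ + stackTotal n ψ := by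
  induction n generalizing φ ψ with
  | zero => rfl
  | succ n ih =>
    simp only [stackTotal, ← ih]
    congr 1
    ext c
    simp [stackSum, sum_add_distrib]

theorem stackTotal_mul_left (n : ℕ) (a : ℝ) (φ : List ℕ → ℝ) :
    stackTotal n (fun c => a * φ c) = a * stackTotal n φ := by
  induction n generalizing φ with
  | zero => rfl
  | succ n ih =>
    simp only [stackTotal, ← ih]
    congr 1
    ext c
    simp [stackSum, mul_sum]

theorem stackTotal_zero_fun (n : ℕ) : stackTotal n (fun _ => 0) = 0 := by
  simpa using stackTotal_mul_left n 0 (fun _ => 0)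

theorem stackTotal_mono (n : ℕ) {φ ψ : List ℕ → ℝ} (h : ∀ c, φ c ≤ ψ c) :
    stackTotal n φ ≤ stackTotal n ψ := by
  induction n generalizing φ ψ with
  | zero => exact h []
  | succ n ih => exact ih fun c => sum_le_sum fun i _ => h _

theorem stackInsert_ne_nil (c : List ℕ) (i : ℕ) : stackInsert c i ≠ [] := by
  cases c with
  | nil => simp [stackInsert]
  | cons b c => simp only [stackInsert]; split_ifs <;> simp

theorem stackTotal_succ_congr (n : ℕ) {φ ψ : List ℕ → ℝ} (h : ∀ c, c ≠ [] → φ c = ψ c) :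
    stackTotal (n + 1) φ = stackTotal (n + 1) ψ := by
  simp only [stackTotal]
  congr 1
  ext c
  exact sum_congr rfl fun i _ => h _ (stackInsert_ne_nil c i)

/-- The sum of `ψ` over all `b` for which an insertion into the bottom block of `c`, or on top of
it, can leave the bottom block `b` with the new element in a block of its own above it. -/
def baseSum (ψ : ℕ → ℝ) : List ℕ → ℝ
  | [] => 0
  | [b] => ψ b + ∑ j ∈ range b, ψ j
  | b :: _ :: _ => ∑ j ∈ range b, ψ j

theorem stackTotal_baseSum_add (n : ℕ) (ψ χ : ℕ → ℝ) :
    stackTotal n (baseSum fun b => ψ b + χ b) =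
      stackTotal n (baseSum ψ) + stackTotal n (baseSum χ) := by
  rw [← stackTotal_add]
  congr 1
  ext c
  rcases c with _ | ⟨b, _ | ⟨b', c⟩⟩ <;> simp only [baseSum, sum_add_distrib] <;> ring

theorem stackTotal_baseSum_mul_right (n : ℕ) (ψ : ℕ → ℝ) (a : ℝ) :
    stackTotal n (baseSum fun b => ψ b * a) = stackTotal n (baseSum ψ) * a := by
  rw [mul_comm, ← stackTotal_mul_left]
  congr 1
  ext c
  rcases c with _ | ⟨b, _ | ⟨b', c⟩⟩ <;> simp only [baseSum, ← sum_mul] <;> ring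

/-- Decomposition of an insertion sequence at the last time the bottom block changed. -/
theorem stackTotal_succ (n : ℕ) (φ : List ℕ → ℝ) :
    stackTotal (n + 1) φ = stackTotal n (fun c => φ [stackSize c]) +
      ∑ x ∈ antidiagonal n, stackTotal x.1
        (baseSum fun b => stackTotal (x.2 + 1) fun c => φ (b :: c)) := by
  induction n generalizing φ with
  | zero => simp [stackTotal, stackSum_nil, stackSize, baseSum]
  | succ n ih =>
    have key : stackTotal (n + 1) (fun c => φ [stackSize c] + baseSum (fun b => φ [b, 0]) c) =
        stackTotal n (fun c => stackSum φ [stackSize c]) +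
        ∑ x ∈ antidiagonal n, stackTotal x.1 (baseSum fun b => stackTotal (x.2 + 1)
          fun c => φ [stackSize (b :: c)] + ∑ j ∈ range b, φ [j, 0]) := by
      rw [ih]
      congr 1
      · congr 1
        ext c
        simp only [baseSum, stackSum_cons, stackSum_nil]
        ring
      · refine sum_congr rfl fun x _ => ?_
        congr 2
        ext b
        refine stackTotal_succ_congr _ fun c hc => ?_
        rcases c with _ | ⟨b', c⟩
        · simp at hc
        · simp [baseSum]
    rw [stackTotal, ih (stackSum φ), Nat.sum_antidiagonal_succ']
    have h0 : stackTotal (n + 1) (baseSum fun b => stackTotal (0 + 1) fun c => φ (b :: c)) =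
        stackTotal (n + 1) (baseSum fun b => φ [b, 0]) := by
      simp [stackTotal, stackSum_nil]
    rw [stackTotal_add] at key
    simp only [h0, stackSum_cons, stackTotal_add _ (fun c => _ + _), stackTotal_baseSum_add,
      sum_add_distrib] at key ⊢
    have h1 (k b : ℕ) : stackTotal (k + 1) (stackSum fun c => φ (b :: c)) =
      stackTotal (k + 1 + 1) fun c => φ (b :: c) := rfl
    simp only [stackTotal_add, h1, stackTotal_baseSum_add, sum_add_distrib] at key ⊢
    linarith

theorem stackTotal_nonneg (n : ℕ) {φ : List ℕ → ℝ} (h : ∀ c, 0 ≤ φ c) :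
    0 ≤ stackTotal n φ := by
  simpa [stackTotal_zero_fun] using stackTotal_mono n (φ := fun _ => 0) h

theorem stackTotal_pow_succ (n : ℕ) (u : ℝ) :
    stackTotal (n + 1) (fun c => u ^ stackSize c) =
      u * stackTotal n (fun c => u ^ stackSize c) +
        ∑ x ∈ antidiagonal n, stackTotal x.1 (baseSum fun b => u ^ (b + 1)) *
          stackTotal (x.2 + 1) fun c => u ^ stackSize c := by
  rw [stackTotal_succ, ← stackTotal_mul_left]
  congr 1
  · congr 1
    ext c
    simp [stackSize, pow_succ, mul_comm]
  · refine sum_congr rfl fun x _ => ?_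
    rw [← stackTotal_baseSum_mul_right]
    congr 2
    ext b
    rw [← stackTotal_mul_left]
    simp [stackSize, pow_add]

/-- `u` to the power of the size of the bottom block. -/
def basePow (u : ℝ) : List ℕ → ℝ
  | [] => 0
  | b :: _ => u ^ (b + 1)

theorem stackTotal_basePow_succ (n : ℕ) (u : ℝ) :
    stackTotal (n + 1) (basePow u) =
      u * stackTotal n (fun c => u ^ stackSize c) +
        ∑ x ∈ antidiagonal n, stackTotal x.1 (baseSum fun b => u ^ (b + 1)) *
          stackTotal (x.2 + 1) fun _ => 1 := by
  rw [stackTotal_succ, ← stackTotal_mul_left]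
  congr 1
  · congr 1
    ext c
    simp [basePow, pow_succ, mul_comm]
  · refine sum_congr rfl fun x _ => ?_
    rw [← stackTotal_baseSum_mul_right]
    congr 2
    ext b
    rw [← stackTotal_mul_left]
    simp [basePow]

theorem stackTotal_baseSum_pow_succ (n : ℕ) (u : ℝ) :
    (1 - u) * stackTotal (n + 1) (baseSum fun b => u ^ (b + 1)) + stackTotal (n + 1) (basePow u) =
      (1 - u) * (u * stackTotal n fun c => u ^ stackSize c) + u * stackTotal (n + 1) fun _ => 1 := by
  set single : List ℕ → ℝ := fun c => if c.length = 1 then u ^ stackSize c else 0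
  have hs : stackTotal (n + 1) single = u * stackTotal n fun c => u ^ stackSize c := by
    rw [stackTotal_succ, ← stackTotal_mul_left, add_eq_left.2]
    · simp [single, stackSize, pow_succ, mul_comm]
    · refine sum_eq_zero fun x _ => ?_
      have h (b : ℕ) : stackTotal (x.2 + 1) (fun c => single (b :: c)) = 0 := by
        rw [← stackTotal_zero_fun (x.2 + 1)]
        exact stackTotal_succ_congr _ fun c hc => by simp [single, hc]
      simpa [h] using stackTotal_baseSum_mul_right x.1 (fun _ => 0) 0
  rw [← hs, ← stackTotal_mul_left, ← stackTotal_mul_left, ← stackTotal_mul_left, ← stackTotal_add,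
    ← stackTotal_add]
  refine stackTotal_succ_congr _ fun c hc => ?_
  have hg (b : ℕ) : (1 - u) * ∑ j ∈ range b, u ^ (j + 1) = u - u ^ (b + 1) := by
    simp only [pow_succ, ← sum_mul]
    linear_combination u * mul_neg_geom_sum u b
  rcases c with _ | ⟨b, _ | ⟨b', c⟩⟩
  · simp at hc
  · simp [baseSum, basePow, single, mul_add, hg, stackSize]
    ring
  · simp [baseSum, basePow, single, hg]

open PowerSeries in
/-- The generating function of insertion sequences, by length and with weight `u` to the power of
the size of the final stack. -/
noncomputable def stackSeries (u : ℝ) : PowerSeries ℝ :=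
  PowerSeries.mk fun n => stackTotal n fun c => u ^ stackSize c

open PowerSeries in
theorem stackSeries_equation (u : ℝ) :
    (stackSeries u - 1) * (stackSeries 1 - C u) =
      X * C u * stackSeries u * (stackSeries 1 - C u) +
      (stackSeries u - 1) * (C u * (stackSeries 1 - 1) - X * C u ^ 2 * stackSeries u) := by
  set K : PowerSeries ℝ := mk fun n => stackTotal n (baseSum fun b => u ^ (b + 1)) with hK
  set R : PowerSeries ℝ := mk fun n => stackTotal n (basePow u) with hR
  set P' : ℝ → PowerSeries ℝ := fun v => mk fun n => stackTotal (n + 1) fun c => v ^ stackSize c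
    with hP'
  have hshift (v : ℝ) : stackSeries v = 1 + X * P' v := by
    ext n
    cases n with
    | zero => simp [stackSeries, stackTotal, stackSize]
    | succ n => simp [stackSeries, hP', coeff_succ_X_mul, coeff_one]
  have hP : P' u = C u * stackSeries u + K * P' u := by
    ext n
    rw [map_add, coeff_C_mul, coeff_mul]
    simpa [hP', hK, stackSeries] using stackTotal_pow_succ n u
  have hR : R = X * (C u * stackSeries u + K * P' 1) := by
    ext n
    cases n with
    | zero => simp [hR, stackTotal, basePow]
    | succ n =>
      rw [coeff_succ_X_mul, map_add, coeff_C_mul, coeff_mul]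
      simpa [hP', hK, hR, stackSeries] using stackTotal_basePow_succ n u
  have hK : C (1 - u) * K + R =
      X * (C (1 - u) * (C u * stackSeries u) + C u * P' 1) := by
    ext n
    cases n with
    | zero => simp [hK, hR, stackTotal, baseSum]
    | succ n =>
      rw [coeff_succ_X_mul, map_add, coeff_C_mul, map_add, coeff_C_mul, coeff_C_mul, coeff_C_mul]
      simpa [hP', hK, ‹R = PowerSeries.mk _›, stackSeries] using stackTotal_baseSum_pow_succ n u
  have h1 : (C (1 - u) : PowerSeries ℝ) = 1 - C u := by simp
  rw [h1] at hK
  have hY := hshift 1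
  have hU := hshift u
  have hS : stackSeries u - 1 = X * C u * stackSeries u + K * (stackSeries u - 1) := by
    linear_combination X * hP + (1 - K) * hU
  have hKY : K * (stackSeries 1 - C u) =
      C u * (stackSeries 1 - 1) - X * C u ^ 2 * stackSeries u := by
    linear_combination hK - hR + (K - C u) * hY
  linear_combination (stackSeries 1 - C u) * hS + (stackSeries u - 1) * hKY

theorem stackTotal_pow_le (n : ℕ) {u : ℝ} (h0 : 0 ≤ u) (h2 : u ≤ 2) :
    stackTotal n (fun c => u ^ stackSize c) ≤ 16 ^ n := by
  set h : List ℕ → ℝ := fun c => 2 ^ stackSize c * 2 ^ c.length with hh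
  have hT (c : List ℕ) : stackSum h c + 4 * 2 ^ stackSize c + 6 ≤ 16 * h c := by
    induction c with
    | nil => norm_num [stackSum_nil, hh, stackSize]
    | cons b c ih =>
      rw [stackSum_cons]
      have h1 : stackSum (fun c' => h (b :: c')) c = 4 * 2 ^ b * stackSum h c := by
        simp only [stackSum, mul_sum]
        refine sum_congr rfl fun i _ => ?_
        simp [hh, stackSize]
        ring
      have h2 : ∑ j ∈ range b, h [j, 0] = 16 * (2 ^ b - 1) := by
        have := mul_neg_geom_sum (2 : ℝ) b
        have h3 : ∑ j ∈ range b, h [j, 0] = 16 * ∑ j ∈ range b, (2 : ℝ) ^ j := by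
          rw [mul_sum]
          refine sum_congr rfl fun i _ => ?_
          simp [hh, stackSize]
          ring
        rw [h3]
        linarith
      have h4 : h [stackSize (b :: c)] = 8 * 2 ^ b * 2 ^ stackSize c := by
        simp [hh, stackSize]
        ring
      have h5 : h (b :: c) = 4 * 2 ^ b * h c := by
        simp [hh, stackSize]
        ring
      have h6 : (2 : ℝ) ^ stackSize (b :: c) = 2 * 2 ^ b * 2 ^ stackSize c := by
        simp [stackSize]
        ring
      rw [h1, h2, h4, h5, h6]
      have hb : (1 : ℝ) ≤ 2 ^ b := one_le_pow₀ one_le_two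
      have hc : (1 : ℝ) ≤ 2 ^ stackSize c := one_le_pow₀ one_le_two
      nlinarith [mul_le_mul_of_nonneg_left ih (zero_le_one.trans hb)]
  have hn : stackTotal n h ≤ 16 ^ n := by
    induction n with
    | zero => simp [stackTotal, hh, stackSize]
    | succ n ih =>
      calc stackTotal n (stackSum h) ≤ stackTotal n (fun c => 16 * h c) :=
            stackTotal_mono n fun c => by
              have : (0 : ℝ) ≤ 2 ^ stackSize c := by positivity
              linarith [hT c]
        _ ≤ _ := by rw [stackTotal_mul_left, pow_succ']; gcongr
  refine (stackTotal_mono n fun c => ?_).trans hn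
  calc u ^ stackSize c ≤ 2 ^ stackSize c * 1 := by rw [mul_one]; gcongr
    _ ≤ h c := by
      refine mul_le_mul_of_nonneg_left ?_ (by positivity)
      exact one_le_pow₀ one_le_two

open PowerSeries in
/-- The power series `f` converges absolutely at `z`, with value `a`. -/
def HasAbsValue (f : PowerSeries ℝ) (z a : ℝ) : Prop :=
  (Summable fun n => ‖coeff n f * z ^ n‖) ∧ ∑' n, coeff n f * z ^ n = a

open PowerSeries in
theorem HasAbsValue.hasSum {f : PowerSeries ℝ} {z a : ℝ} (h : HasAbsValue f z a) :
    HasSum (fun n => coeff n f * z ^ n) a :=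
  h.2 ▸ h.1.of_norm.hasSum

open PowerSeries in
theorem hasAbsValue_monomial (k : ℕ) (r z : ℝ) : HasAbsValue (monomial k r) z (r * z ^ k) := by
  have h (n : ℕ) (hn : n ≠ k) : coeff n (monomial k r) * z ^ n = 0 := by
    simp [coeff_monomial, hn]
  constructor
  · refine summable_of_ne_finset_zero (s := {k}) fun n hn => ?_
    rw [h n (by simpa using hn), norm_zero]
  · rw [tsum_eq_single k h]
    simp

open PowerSeries in
theorem hasAbsValue_C (r z : ℝ) : HasAbsValue (C r) z r := by
  simpa using hasAbsValue_monomial 0 r z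

theorem hasAbsValue_one (z : ℝ) : HasAbsValue 1 z 1 := by
  simpa using hasAbsValue_C 1 z

open PowerSeries in
theorem hasAbsValue_X (z : ℝ) : HasAbsValue X z z := by
  simpa [X_eq] using hasAbsValue_monomial 1 1 z

namespace HasAbsValue

variable {f g : PowerSeries ℝ} {z a b : ℝ}

theorem add (hf : HasAbsValue f z a) (hg : HasAbsValue g z b) : HasAbsValue (f + g) z (a + b) := by
  constructor
  · refine Summable.of_nonneg_of_le (fun _ => norm_nonneg _) (fun n => ?_) (hf.1.add hg.1)
    rw [map_add, add_mul]
    exact norm_add_le _ _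
  · simpa [add_mul] using (hf.hasSum.add hg.hasSum).tsum_eq

theorem mul (hf : HasAbsValue f z a) (hg : HasAbsValue g z b) : HasAbsValue (f * g) z (a * b) := by
  have h (n : ℕ) : PowerSeries.coeff n (f * g) * z ^ n = ∑ x ∈ antidiagonal n,
      PowerSeries.coeff x.1 f * z ^ x.1 * (PowerSeries.coeff x.2 g * z ^ x.2) := by
    rw [PowerSeries.coeff_mul, sum_mul]
    refine sum_congr rfl fun x hx => ?_
    rw [← mem_antidiagonal.1 hx, pow_add]
    ring
  constructor
  · simpa only [h] using summable_norm_sum_mul_antidiagonal_of_summable_norm hf.1 hg.1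
  · simp only [h, ← hf.2, ← hg.2]
    exact (tsum_mul_tsum_eq_tsum_sum_antidiagonal_of_summable_norm hf.1 hg.1).symm

theorem sub (hf : HasAbsValue f z a) (hg : HasAbsValue g z b) : HasAbsValue (f - g) z (a - b) := by
  simpa [sub_eq_add_neg] using hf.add ((hasAbsValue_C (-1) z).mul hg)

theorem pow (hf : HasAbsValue f z a) (n : ℕ) : HasAbsValue (f ^ n) z (a ^ n) := by
  induction n with
  | zero => simpa using hasAbsValue_one z
  | succ n ih => simpa [pow_succ] using ih.mul hf

theorem unique (hf : HasAbsValue f z a) (hg : HasAbsValue f z b) : a = b :=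
  hf.2.symm.trans hg.2

end HasAbsValue

open PowerSeries in
theorem PowerSeries.eq_zero_of_hasAbsValue {f : PowerSeries ℝ} {r : ℝ} (hr : 0 < r)
    (h : ∀ z, 0 < z → z ≤ r → HasAbsValue f z 0) : f = 0 := by
  ext n
  induction n using Nat.strong_induction_on with
  | _ n ih =>
    have hs : Summable fun m => ‖coeff (m + (n + 1)) f * r ^ (m + (n + 1))‖ :=
      (summable_nat_add_iff (n + 1)).2 (h r hr le_rfl).1
    set M := ∑' m, ‖coeff (m + (n + 1)) f * r ^ (m + (n + 1))‖
    have hM (z : ℝ) (h0 : 0 < z) (hz : z ≤ r) : |coeff n f| * r ^ (n + 1) ≤ z * M := by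
      have h1 := (h z h0 hz).1.of_norm.sum_add_tsum_nat_add (n + 1)
      rw [(h z h0 hz).2, sum_range_succ, sum_eq_zero, zero_add] at h1
      · have h2 (m : ℕ) : ‖coeff (m + (n + 1)) f * z ^ (m + (n + 1))‖ ≤
            (z / r) ^ (n + 1) * ‖coeff (m + (n + 1)) f * r ^ (m + (n + 1))‖ := by
          rw [norm_mul, norm_mul, norm_pow, norm_pow, Real.norm_of_nonneg h0.le,
            Real.norm_of_nonneg hr.le, mul_left_comm]
          gcongr
          rw [div_pow, pow_add z, pow_add r]
          have : z ^ m ≤ r ^ m := by gcongr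
          calc z ^ m * z ^ (n + 1) ≤ r ^ m * z ^ (n + 1) := by gcongr
            _ = _ := by rw [pow_add r]; field_simp; ring
        have h3 := tsum_of_norm_bounded (hs.hasSum.mul_left ((z / r) ^ (n + 1))) h2
        rw [← neg_eq_iff_add_eq_zero] at h1
        rw [← h1, norm_neg, norm_mul, norm_pow, Real.norm_of_nonneg h0.le, Real.norm_eq_abs,
          div_pow, pow_succ z] at h3
        have h4 : |coeff n f| * z ^ n * r ^ (n + 1) ≤ z ^ n * z * M := by
          calc |coeff n f| * z ^ n * r ^ (n + 1) ≤
              z ^ n * z / r ^ (n + 1) * M * r ^ (n + 1) := by gcongr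
            _ = _ := by field_simp
        have h5 : 0 < z ^ n := by positivity
        refine le_of_mul_le_mul_left ?_ h5
        linarith
      · intro i hi
        rw [ih i (mem_range.1 hi)]
        simp
    have hlim : Filter.Tendsto (fun z : ℝ => z * M) (nhdsWithin 0 (Set.Ioi 0)) (nhds 0) := by
      have : Filter.Tendsto (fun z : ℝ => z * M) (nhds 0) (nhds (0 * M)) :=
        Filter.tendsto_id.mul_const M
      rw [zero_mul] at this
      exact this.mono_left nhdsWithin_le_nhds
    have h6 : |coeff n f| * r ^ (n + 1) ≤ 0 := by
      refine ge_of_tendsto hlim ?_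
      filter_upwards [Ioc_mem_nhdsGT hr] with z hz using hM z hz.1 hz.2
    have h7 : 0 < r ^ (n + 1) := by positivity
    have h8 : |coeff n f| ≤ 0 := by
      by_contra! h9
      exact absurd (mul_pos h9 h7) (not_lt.2 h6)
    simpa using h8

theorem stackSeries_hasAbsValue {u z : ℝ} (h0 : 0 ≤ u) (h2 : u ≤ 2) (hz0 : 0 < z)
    (hz : z ≤ 1 / 32) :
    HasAbsValue (stackSeries u) z (∑' n, PowerSeries.coeff n (stackSeries u) * z ^ n) := by
  refine ⟨?_, rfl⟩
  refine Summable.of_nonneg_of_le (fun _ => norm_nonneg _) (fun n => ?_)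
    (summable_geometric_of_lt_one (r := 1 / 2) (by norm_num) (by norm_num))
  have h1 : 0 ≤ stackTotal n fun c => u ^ stackSize c :=
    stackTotal_nonneg n fun c => pow_nonneg h0 _
  rw [stackSeries, PowerSeries.coeff_mk, norm_mul, norm_pow, Real.norm_of_nonneg h1,
    Real.norm_of_nonneg hz0.le]
  calc _ ≤ (16 : ℝ) ^ n * (1 / 32) ^ n := by gcongr; exact stackTotal_pow_le n h0 h2
    _ = (1 / 2) ^ n := by rw [← mul_pow]; norm_num

/-- The quadratic method: the discriminant of the equation for `stackSeries u` has a double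
root. -/
theorem algebraic_of_square {z Y : ℝ} {S : ℝ → ℝ} (hz : 0 < z) (hz' : z ≤ 1 / 32) (hY : 1 ≤ Y)
    (hc : ContinuousOn S (Set.Icc 0 2)) (hS2 : S 2 ≤ 2)
    (h : ∀ u ∈ Set.Icc (0 : ℝ) 2,
      (S u - 1) * (Y - u) = z * u * S u * (Y - u) + (S u - 1) * (u * (Y - 1) - z * u ^ 2 * S u)) :
    (1 + z) ^ 3 * Y ^ 2 - (1 + 20 * z - 8 * z ^ 2) * Y + 16 * z = 0 := by
  set δ : ℝ → ℝ := fun u => Y * (1 - (1 + z) * u) ^ 2 + 4 * z * u ^ 2 * (1 - u) with hδ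
  set g : ℝ → ℝ := fun u => 2 * z * u ^ 2 * S u + Y * (1 - u - z * u) with hg
  have hgδ (u : ℝ) (hu : u ∈ Set.Icc (0 : ℝ) 2) : g u ^ 2 = Y * δ u := by
    simp only [hg, hδ]
    linear_combination (4 * z * u ^ 2) * h u hu
  have hgc : ContinuousOn g (Set.Icc 0 2) := by fun_prop
  have hg0 : 0 < g 0 := by simp [hg]; linarith
  have hg2 : g 2 < 0 := by simp only [hg]; nlinarith
  obtain ⟨u, hu, hgu⟩ : ∃ u ∈ Set.Ioo (0 : ℝ) 2, g u = 0 := by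
    obtain ⟨u, hu, hgu⟩ := intermediate_value_Icc' (by norm_num : (0 : ℝ) ≤ 2) hgc
      (Set.mem_Icc.2 ⟨hg2.le, hg0.le⟩)
    refine ⟨u, ⟨lt_of_le_of_ne hu.1 ?_, lt_of_le_of_ne hu.2 ?_⟩, hgu⟩
    · rintro rfl
      exact hg0.ne' hgu
    · rintro rfl
      exact hg2.ne hgu
  have hY0 : 0 < Y := by linarith
  have hδu : δ u = 0 := by
    have := hgδ u ⟨hu.1.le, hu.2.le⟩
    rw [hgu] at this
    simpa [hY0.ne'] using this.symm
  have hmin : IsLocalMin δ u := by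
    filter_upwards [Ioo_mem_nhds hu.1 hu.2] with v hv
    rw [hδu]
    have := hgδ v ⟨hv.1.le, hv.2.le⟩
    by_contra! hneg
    nlinarith [sq_nonneg (g v), mul_neg_of_pos_of_neg hY0 hneg]
  have hder : HasDerivAt δ (Y * (2 * (1 - (1 + z) * u) * -(1 + z)) +
      (8 * z * u - 12 * z * u ^ 2)) u := by
    have h1 : HasDerivAt (fun u : ℝ => 1 - (1 + z) * u) (-(1 + z)) u := by
      simpa using ((hasDerivAt_id u).const_mul (1 + z)).const_sub 1
    have h2 : HasDerivAt (fun u : ℝ => 4 * z * u ^ 2 - 4 * z * u ^ 3)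
        (8 * z * u - 12 * z * u ^ 2) u := by
      refine (((hasDerivAt_pow 2 u).const_mul (4 * z)).sub
        ((hasDerivAt_pow 3 u).const_mul (4 * z))).congr_deriv ?_
      push_cast
      ring
    have h3 : δ = (fun y => Y * ((fun u => 1 - (1 + z) * u) ^ 2) y) +
        fun u => 4 * z * u ^ 2 - 4 * z * u ^ 3 := by
      ext v
      simp only [hδ, Pi.add_apply, Pi.pow_apply]
      ring
    rw [h3]
    refine (((h1.pow 2).const_mul Y).add h2).congr_deriv ?_
    norm_num
  have hd := hmin.hasDerivAt_eq_zero hder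
  have hu0 : u ≠ 0 := hu.1.ne'
  simp only [hδ] at hδu
  have hu1 : u ≠ 1 := by
    rintro rfl
    nlinarith [mul_pos hY0 (pow_pos hz 2)]
  have hquad : (1 + z) * u ^ 2 - 3 * u + 2 = 0 := by
    have : 4 * z * u * ((1 + z) * u ^ 2 - 3 * u + 2) = 0 := by
      linear_combination 2 * (1 + z) * hδu + (1 - (1 + z) * u) * hd
    simpa [hz.ne', hu0] using this
  have hzu : z = (3 * u - 2) / u ^ 2 - 1 := by
    field_simp
    linarith
  have hYu : Y = u ^ 2 * (2 - u) := by
    have h1 : u * (1 - (1 + z) * u) = 2 * (1 - u) := by linear_combination -hquad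
    have h2 : 4 * (1 - u) * ((1 - u) * (Y - u ^ 2 * (2 - u))) = 0 := by
      linear_combination u ^ 2 * hδu - Y * (u * (1 - (1 + z) * u) + 2 * (1 - u)) * h1 -
        4 * u ^ 2 * (1 - u) * hquad
    have h3 : 1 - u ≠ 0 := sub_ne_zero.2 hu1.symm
    have : Y - u ^ 2 * (2 - u) = 0 := by simpa [h3] using h2
    linarith
  rw [hYu, hzu]
  field_simp
  ring

open PowerSeries in
theorem stackSeries_one_algebraic :
    (1 + X) ^ 3 * stackSeries 1 ^ 2 - (1 + C 20 * X - C 8 * X ^ 2) * stackSeries 1 + C 16 * X =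
      0 := by
  refine PowerSeries.eq_zero_of_hasAbsValue (r := 1 / 32) (by norm_num) fun z hz0 hz => ?_
  have hS (u : ℝ) (hu : u ∈ Set.Icc (0 : ℝ) 2) := stackSeries_hasAbsValue hu.1 hu.2 hz0 hz
  set S : ℝ → ℝ := fun u => ∑' n, coeff n (stackSeries u) * z ^ n with hSdef
  have hnn (u : ℝ) (hu : 0 ≤ u) (n : ℕ) : 0 ≤ coeff n (stackSeries u) := by
    rw [stackSeries, coeff_mk]
    exact stackTotal_nonneg n fun c => pow_nonneg hu _
  have hle (u : ℝ) (hu : u ∈ Set.Icc (0 : ℝ) 2) (n : ℕ) :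
      coeff n (stackSeries u) * z ^ n ≤ (1 / 2) ^ n := by
    rw [stackSeries, coeff_mk]
    calc _ ≤ (16 : ℝ) ^ n * (1 / 32) ^ n := by gcongr; exact stackTotal_pow_le n hu.1 hu.2
      _ = (1 / 2) ^ n := by rw [← mul_pow]; norm_num
  have hgeom : Summable fun n : ℕ => (1 / 2 : ℝ) ^ n := summable_geometric_two
  have hY := hS 1 (by norm_num)
  have key := algebraic_of_square (Y := S 1) (S := S) hz0 hz ?_ ?_ ?_ ?_
  · rw [← key]
    have h1 := (hasAbsValue_one z).add (hasAbsValue_X z)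
    exact (((h1.pow 3).mul (hY.pow 2)).sub (((((hasAbsValue_one z).add ((hasAbsValue_C 20 z).mul
      (hasAbsValue_X z))).sub ((hasAbsValue_C 8 z).mul ((hasAbsValue_X z).pow 2)))).mul hY)).add
      ((hasAbsValue_C 16 z).mul (hasAbsValue_X z))
  · have := hY.1.of_norm.le_tsum 0 fun n _ => mul_nonneg (hnn 1 zero_le_one n) (by positivity)
    simpa [hSdef, stackSeries, stackTotal, stackSize] using this
  · refine continuousOn_tsum (u := fun n : ℕ => (1 / 2 : ℝ) ^ n) (fun n => ?_) hgeom fun n u hu => ?_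
    · simp only [stackSeries, coeff_mk]
      have (φ : ℝ → List ℕ → ℝ) (hφ : ∀ c, Continuous fun u => φ u c) :
          Continuous fun u => stackTotal n (φ u) := by
        induction n generalizing φ with
        | zero => exact hφ []
        | succ n ih => exact ih _ fun c => continuous_finsetSum _ fun i _ => hφ _
      exact ((this (fun u c => u ^ stackSize c) fun c => by fun_prop).mul
        continuous_const).continuousOn
    · rw [Real.norm_of_nonneg (mul_nonneg (hnn u hu.1 n) (by positivity))]
      exact hle u hu n
  · have h2 : (2 : ℝ) ∈ Set.Icc (0 : ℝ) 2 := by norm_num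
    refine le_of_le_of_eq ?_ tsum_geometric_two
    exact (hS 2 h2).1.of_norm.tsum_le_tsum (hle 2 h2) hgeom
  · intro u hu
    have h1 := hasAbsValue_one z
    have hX := hasAbsValue_X z
    have hU := hasAbsValue_C u z
    have hSu := hS u hu
    have hl := (hSu.sub h1).mul (hY.sub hU)
    rw [stackSeries_equation u] at hl
    exact hl.unique ((((hX.mul hU).mul hSu).mul (hY.sub hU)).add ((hSu.sub h1).mul
      ((hU.mul (hY.sub h1)).sub ((hX.mul (hU.pow 2)).mul hSu))))

open PowerSeries in
/-- The coefficients of `f` are `O(8 ^ n)`. -/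
def CoeffBound (f : PowerSeries ℝ) : Prop :=
  ∃ A, ∀ n, |coeff n f| ≤ A * 8 ^ n

namespace CoeffBound

open PowerSeries

theorem add {f g : PowerSeries ℝ} (hf : CoeffBound f) (hg : CoeffBound g) :
    CoeffBound (f + g) := by
  obtain ⟨A, hA⟩ := hf
  obtain ⟨B, hB⟩ := hg
  refine ⟨A + B, fun n => ?_⟩
  rw [map_add, add_mul]
  exact (abs_add_le _ _).trans (add_le_add (hA n) (hB n))

theorem C_mul {f : PowerSeries ℝ} (hf : CoeffBound f) (a : ℝ) : CoeffBound (C a * f) := by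
  obtain ⟨A, hA⟩ := hf
  refine ⟨|a| * A, fun n => ?_⟩
  rw [coeff_C_mul, abs_mul, mul_assoc]
  exact mul_le_mul_of_nonneg_left (hA n) (abs_nonneg a)

theorem X_mul {f : PowerSeries ℝ} (hf : CoeffBound f) : CoeffBound (X * f) := by
  obtain ⟨A, hA⟩ := hf
  have hA0 : 0 ≤ A := by simpa using (abs_nonneg _).trans (hA 0)
  refine ⟨A, fun n => ?_⟩
  cases n with
  | zero => simpa using hA0
  | succ n =>
    rw [coeff_succ_X_mul]
    refine (hA n).trans (mul_le_mul_of_nonneg_left ?_ hA0)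
    exact pow_le_pow_right₀ (by norm_num) n.le_succ

theorem one : CoeffBound 1 := by
  refine ⟨1, fun n => ?_⟩
  rw [coeff_one, one_mul]
  split_ifs
  · simpa using one_le_pow₀ (by norm_num : (1 : ℝ) ≤ 8)
  · simp

theorem of_one_add_X_mul {f : PowerSeries ℝ} (hf : CoeffBound ((1 + X) * f)) : CoeffBound f := by
  obtain ⟨A, hA⟩ := hf
  have hA0 : 0 ≤ A := by simpa using (abs_nonneg _).trans (hA 0)
  refine ⟨2 * A, fun n => ?_⟩
  induction n with
  | zero =>
    have := hA 0
    simp [add_mul] at this ⊢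
    linarith
  | succ n ih =>
    have := hA (n + 1)
    rw [add_mul, one_mul, map_add, coeff_succ_X_mul] at this
    have h1 : |coeff (n + 1) f| ≤ |coeff (n + 1) f + coeff n f| + |coeff n f| := by
      simpa using abs_sub (coeff (n + 1) f + coeff n f) (coeff n f)
    have h2 : 0 ≤ A * 8 ^ n := by positivity
    rw [pow_succ] at this ⊢
    linarith

end CoeffBound

open PowerSeries in
theorem stackSeries_one_discriminant :
    (C 2 * (1 + X) ^ 3 * stackSeries 1 - (1 + C 20 * X - C 8 * X ^ 2)) ^ 2 =
      (1 - C 8 * X) ^ 3 := by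
  have h (n : ℕ) [n.AtLeastTwo] : (C (OfNat.ofNat n : ℝ) : PowerSeries ℝ) = OfNat.ofNat n :=
    map_ofNat C n
  have := stackSeries_one_algebraic
  simp only [h] at this ⊢
  linear_combination (4 * (1 + X) ^ 3) * this

open PowerSeries in
theorem constantCoeff_stackSeries (u : ℝ) : constantCoeff (stackSeries u) = 1 := by
  rw [← coeff_zero_eq_constantCoeff_apply, stackSeries, coeff_mk]
  simp [stackTotal, stackSize]

open PowerSeries in
theorem stackTotal_one_le : ∃ A, ∀ n, stackTotal n (fun _ => 1) ≤ A * 8 ^ n := by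
  have hC (n : ℕ) [n.AtLeastTwo] : (C (OfNat.ofNat n : ℝ) : PowerSeries ℝ) = OfNat.ofNat n :=
    map_ofNat C n
  set c : PowerSeries ℝ := mk fun n => (catalan n : ℝ) * 2 ^ n with hc
  have hcb : CoeffBound c := by
    refine ⟨1, fun n => ?_⟩
    have h1 : catalan n ≤ 4 ^ n := by
      calc catalan n ≤ (n + 1) * catalan n := Nat.le_mul_of_pos_left _ n.succ_pos
        _ = (2 * n).choose n := succ_mul_catalan_eq_centralBinom n
        _ ≤ 2 ^ (2 * n) := Nat.choose_le_two_pow _ _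
        _ = 4 ^ n := by rw [pow_mul]; norm_num
    have h2 : (catalan n : ℝ) ≤ 4 ^ n := by exact_mod_cast h1
    rw [hc, coeff_mk, abs_of_nonneg (by positivity), one_mul]
    calc (catalan n : ℝ) * 2 ^ n ≤ 4 ^ n * 2 ^ n := by gcongr
      _ = 8 ^ n := by rw [← mul_pow]; norm_num
  have hceq : c = 1 + C 2 * (X * c ^ 2) := by
    ext n
    cases n with
    | zero => simp [hc]
    | succ n =>
      rw [map_add, coeff_C_mul, coeff_succ_X_mul, sq, coeff_mul, hc]
      simp only [coeff_mk, coeff_one, n.succ_ne_zero, if_false, zero_add, catalan_succ']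
      push_cast
      rw [sum_mul, mul_sum]
      refine sum_congr rfl fun x hx => ?_
      rw [← mem_antidiagonal.1 hx, pow_succ, pow_add]
      ring
  set s : PowerSeries ℝ := 1 - C 4 * (X * c) with hs
  have hs2 : s ^ 2 = 1 - C 8 * X := by
    simp only [hC] at hceq hs ⊢
    rw [hs]
    linear_combination (-8 * X) * hceq
  have hW : C 2 * (1 + X) ^ 3 * stackSeries 1 - (1 + C 20 * X - C 8 * X ^ 2) =
      (1 - C 8 * X) * s := by
    have h1 : (C 2 * (1 + X) ^ 3 * stackSeries 1 - (1 + C 20 * X - C 8 * X ^ 2)) ^ 2 =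
        ((1 - C 8 * X) * s) ^ 2 := by
      rw [stackSeries_one_discriminant, mul_pow, hs2]
      ring
    rcases sq_eq_sq_iff_eq_or_eq_neg.1 h1 with h2 | h2
    · exact h2
    · have := congrArg constantCoeff h2
      simp [constantCoeff_stackSeries, hs] at this
  have hX : CoeffBound X := by simpa using CoeffBound.one.X_mul
  have hsb : CoeffBound s := by
    convert CoeffBound.one.add (hcb.X_mul.C_mul (-4)) using 1
    rw [hs, map_neg]
    ring
  have h1 : CoeffBound ((1 + X) * ((1 + X) * ((1 + X) * stackSeries 1))) := by
    have h2 : (1 + X) * ((1 + X) * ((1 + X) * stackSeries 1)) =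
        C (1 / 2) * ((s + C (-8) * (X * s)) + (1 + C 20 * X + C (-8) * (X * X))) := by
      have h3 : (C (1 / 2) * C 2 : PowerSeries ℝ) = 1 := by
        rw [← map_mul]
        norm_num
      rw [map_neg]
      linear_combination C (1 / 2) * hW - (1 + X) ^ 3 * stackSeries 1 * h3
    rw [h2]
    exact ((hsb.add (hsb.X_mul.C_mul _)).add
      ((CoeffBound.one.add (hX.C_mul _)).add (hX.X_mul.C_mul _))).C_mul _
  obtain ⟨A, hA⟩ := h1.of_one_add_X_mul.of_one_add_X_mul.of_one_add_X_mul
  refine ⟨A, fun n => le_of_eq_of_le ?_ ((le_abs_self _).trans (hA n))⟩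
  simp [stackSeries]

open PowerSeries in
theorem not_stackTotal_one_le {l : ℝ} (h0 : 0 < l) (h8 : l < 8) (A : ℝ) :
    ¬ ∀ n, stackTotal n (fun _ => 1) ≤ A * l ^ n := by
  intro h
  obtain ⟨z, hz1, hz2⟩ := exists_between (show (1 : ℝ) / 8 < 1 / l by gcongr)
  have hz0 : 0 < z := lt_trans (by norm_num) hz1
  have hlz : l * z < 1 := by
    rw [lt_div_iff₀ h0] at hz2
    linarith
  have hS : HasAbsValue (stackSeries 1) z (∑' n, coeff n (stackSeries 1) * z ^ n) := by
    refine ⟨?_, rfl⟩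
    refine Summable.of_nonneg_of_le (fun _ => norm_nonneg _) (fun n => ?_)
      ((summable_geometric_of_lt_one (r := l * z) (by positivity) hlz).mul_left A)
    have h1 : 0 ≤ stackTotal n fun _ => 1 := stackTotal_nonneg n fun c => zero_le_one
    simp only [stackSeries, coeff_mk, one_pow]
    rw [norm_mul, norm_pow, Real.norm_of_nonneg h1, Real.norm_of_nonneg hz0.le, mul_pow,
      ← mul_assoc]
    gcongr
    exact h n
  set Y := ∑' n, coeff n (stackSeries 1) * z ^ n
  have h1 := hasAbsValue_one z
  have hX := hasAbsValue_X z
  have hl := (((((hasAbsValue_C 2 z).mul ((h1.add hX).pow 3)).mul hS).sub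
    ((h1.add ((hasAbsValue_C 20 z).mul hX)).sub ((hasAbsValue_C 8 z).mul (hX.pow 2)))).pow 2)
  rw [stackSeries_one_discriminant] at hl
  have hr := (h1.sub ((hasAbsValue_C 8 z).mul hX)).pow 3
  have h2 := hl.unique hr
  have h3 : (1 - 8 * z) ^ 3 < 0 := Odd.pow_neg (by decide) (by linarith)
  rw [← h2] at h3
  exact absurd h3 (not_lt.2 (sq_nonneg _))

/-- `IsCut c i` says that height `i` is a boundary between consecutive blocks of the stack `c`. -/
def IsCut : List ℕ → ℕ → Prop
  | [], i => i = 0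
  | b :: c, i => i = 0 ∨ (b + 1 ≤ i ∧ IsCut c (i - (b + 1)))

theorem isCut_stackSize (c : List ℕ) : IsCut c (stackSize c) := by
  induction c with
  | nil => simp [IsCut, stackSize]
  | cons b c ih => exact Or.inr ⟨by simp [stackSize], by simpa [stackSize] using ih⟩

theorem stackSize_stackInsert_of_isCut {c : List ℕ} {i : ℕ} (hi : i ≤ stackSize c)
    (h : IsCut c i) : stackSize (stackInsert c i) = stackSize c + 1 := by
  induction c generalizing i with
  | nil => simp [stackInsert, stackSize]
  | cons b c ih =>
    simp only [stackSize, stackInsert, IsCut] at *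
    rcases h with rfl | ⟨h1, h2⟩
    · simp [stackSize]
    · rw [if_neg (by omega), if_neg (by omega)]
      simp only [stackSize]
      rw [ih (by omega) h2]
      omega

theorem stackSize_stackInsert_of_not_isCut {c : List ℕ} {i : ℕ} (hi : i ≤ stackSize c)
    (h : ¬ IsCut c i) : stackSize (stackInsert c i) = i + 1 := by
  induction c generalizing i with
  | nil => exact absurd (by simpa [stackSize, IsCut] using hi) h
  | cons b c ih =>
    simp only [stackSize, stackInsert, IsCut] at *
    rw [not_or, not_and] at h
    rw [if_neg h.1]
    split_ifs with h1
    · simp only [stackSize]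
      omega
    · simp only [stackSize]
      rw [ih (by omega) (h.2 (by omega))]
      omega

theorem isCut_stackInsert_of_isCut {c : List ℕ} {i : ℕ} (hi : i ≤ stackSize c)
    (h : IsCut c i) (j : ℕ) :
    IsCut (stackInsert c i) j ↔ (j ≤ i ∧ IsCut c j) ∨ j = stackSize c + 1 := by
  induction c generalizing i j with
  | nil =>
    simp only [stackSize, stackInsert, IsCut] at *
    omega
  | cons b c ih =>
    simp only [stackSize, stackInsert, IsCut] at *
    rcases h with rfl | ⟨h1, h2⟩
    · simp only [if_true, IsCut]
      omega
    · rw [if_neg (by omega), if_neg (by omega)]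
      simp only [IsCut]
      rw [ih (by omega) h2]
      by_cases h3 : b + 1 ≤ j
      · have e1 : j - (b + 1) ≤ i - (b + 1) ↔ j ≤ i := by omega
        have e2 : j - (b + 1) = stackSize c + 1 ↔ j = b + 1 + stackSize c + 1 := by omega
        have e3 : j ≠ 0 := by omega
        simp only [e1, e2, e3, h3, true_and, false_or]
      · simp only [h3, false_and, or_false]
        omega

theorem isCut_stackInsert_of_not_isCut {c : List ℕ} {i : ℕ} (hi : i ≤ stackSize c)
    (h : ¬ IsCut c i) (j : ℕ) :
    IsCut (stackInsert c i) j ↔ (j ≤ i ∧ IsCut c j) ∨ j = i ∨ j = i + 1 := by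
  induction c generalizing i j with
  | nil => exact absurd (by simpa [stackSize, IsCut] using hi) h
  | cons b c ih =>
    simp only [stackSize, stackInsert, IsCut] at *
    rw [not_or, not_and] at h
    rw [if_neg h.1]
    split_ifs with h1
    · simp only [IsCut]
      have : j ≤ i → ¬ b + 1 ≤ j := by omega
      constructor
      · omega
      · rintro (⟨h2, h3 | h3⟩ | h3)
        · omega
        · exact absurd h3.1 (this h2)
        · omega
    · simp only [IsCut]
      rw [ih (by omega) (h.2 (by omega))]
      by_cases h3 : b + 1 ≤ j
      · have e1 : j - (b + 1) ≤ i - (b + 1) ↔ j ≤ i := by omega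
        have e2 : j - (b + 1) = i - (b + 1) ↔ j = i := by omega
        have e3 : j - (b + 1) = i - (b + 1) + 1 ↔ j = i + 1 := by omega
        have e4 : j ≠ 0 := by omega
        simp only [e1, e2, e3, e4, h3, true_and, false_or]
      · simp only [h3, false_and, or_false]
        omega

/-- Prepend the value `v` to the permutation `σ`, shifting the values `≥ v` of `σ` up by one. -/
def consPerm {n : ℕ} (v : Fin (n + 1)) (σ : Equiv.Perm (Fin n)) : Equiv.Perm (Fin (n + 1)) :=
  ((finSuccEquiv' 0).trans (Equiv.optionCongr σ)).trans (finSuccEquiv' v).symm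

theorem consPerm_zero {n : ℕ} (v : Fin (n + 1)) (σ : Equiv.Perm (Fin n)) :
    consPerm v σ 0 = v := by
  simp [consPerm]

theorem consPerm_succ {n : ℕ} (v : Fin (n + 1)) (σ : Equiv.Perm (Fin n)) (x : Fin n) :
    consPerm v σ x.succ = v.succAbove (σ x) := by
  simp [consPerm, finSuccEquiv'_zero]

theorem consPerm_succ_val {n : ℕ} (v : Fin (n + 1)) (σ : Equiv.Perm (Fin n)) (x : Fin n) :
    (consPerm v σ x.succ : ℕ) = if (σ x : ℕ) < v then (σ x : ℕ) else σ x + 1 := by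
  rw [consPerm_succ, Fin.succAbove]
  simp only [Fin.lt_def, Fin.val_castSucc]
  split_ifs <;> simp

theorem consPerm_bijective (n : ℕ) :
    Function.Bijective fun x : Fin (n + 1) × Equiv.Perm (Fin n) => consPerm x.1 x.2 := by
  rw [Fintype.bijective_iff_injective_and_card]
  constructor
  · rintro ⟨v, σ⟩ ⟨w, τ⟩ h
    have hv : v = w := by simpa [consPerm_zero] using DFunLike.congr_fun h 0
    subst hv
    have hσ : σ = τ := by
      ext x
      have := DFunLike.congr_fun h x.succ
      simp only [consPerm_succ] at this
      rw [Fin.succAbove_right_injective this]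
    rw [hσ]
  · simp [Fintype.card_perm, Nat.factorial_succ]

/-- Decomposition of a permutation into its first value and the pattern of the rest. -/
noncomputable def consPermEquiv (n : ℕ) :
    Fin (n + 1) × Equiv.Perm (Fin n) ≃ Equiv.Perm (Fin (n + 1)) :=
  Equiv.ofBijective _ (consPerm_bijective n)

/-- `σ` avoids the pattern 4213. -/
def Avoids4213 {n : ℕ} (σ : Equiv.Perm (Fin n)) : Prop :=
  ∀ a b c d : Fin n, a < b → b < c → c < d → σ c < σ b → σ b < σ d → ¬ σ d < σ a

/-- The values of `σ` below `j` avoid the pattern 213. -/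
def Avoids213Below {n : ℕ} (σ : Equiv.Perm (Fin n)) (j : ℕ) : Prop :=
  ∀ a b c : Fin n, a < b → b < c → σ b < σ a → σ a < σ c → ¬ (σ c : ℕ) < j

theorem avoids4213_consPerm {n : ℕ} (v : Fin (n + 1)) (σ : Equiv.Perm (Fin n)) :
    Avoids4213 (consPerm v σ) ↔ Avoids4213 σ ∧ Avoids213Below σ v := by
  have hv := consPerm_succ_val v σ
  have h0 := consPerm_zero v σ
  constructor
  · intro h
    constructor
    · intro a b c d hab hbc hcd h1 h2 h3
      refine h a.succ b.succ c.succ d.succ (by simpa) (by simpa) (by simpa) ?_ ?_ ?_ <;>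
      · rw [Fin.lt_def] at h1 h2 h3 ⊢
        rw [hv, hv]
        split_ifs <;> omega
    · intro a b c hab hbc h1 h2 h3
      refine h 0 a.succ b.succ c.succ (Fin.succ_pos a) (by simpa) (by simpa) ?_ ?_ ?_
      · rw [Fin.lt_def] at h1 ⊢
        rw [hv, hv]
        split_ifs <;> omega
      · rw [Fin.lt_def] at h2 ⊢
        rw [hv, hv]
        split_ifs <;> omega
      · rw [Fin.lt_def, hv, h0, if_pos h3]
        exact h3
  · rintro ⟨hσ, hA⟩ a b c d hab hbc hcd h1 h2 h3
    obtain ⟨b, rfl⟩ := Fin.exists_succ_eq.2 (ne_of_gt (lt_of_le_of_lt (Fin.zero_le a) hab))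
    obtain ⟨c, rfl⟩ := Fin.exists_succ_eq.2 (ne_of_gt (lt_of_le_of_lt (Fin.zero_le b.succ) hbc))
    obtain ⟨d, rfl⟩ := Fin.exists_succ_eq.2 (ne_of_gt (lt_of_le_of_lt (Fin.zero_le c.succ) hcd))
    rw [Fin.succ_lt_succ_iff] at hbc hcd
    rw [Fin.lt_def, hv, hv] at h1 h2
    have h1' : σ c < σ b := by
      rw [Fin.lt_def]
      split_ifs at h1 <;> omega
    have h2' : σ b < σ d := by
      rw [Fin.lt_def]
      split_ifs at h2 <;> omega
    cases a using Fin.cases with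
    | zero =>
      refine hA b c d hbc hcd h1' h2' ?_
      rw [Fin.lt_def, hv, h0] at h3
      split_ifs at h3 <;> omega
    | succ a =>
      refine hσ a b c d (by simpa using hab) hbc hcd h1' h2' ?_
      rw [Fin.lt_def, hv, hv] at h3
      rw [Fin.lt_def]
      split_ifs at h3 <;> omega

/-- The stack `c` records the allowed first values of a one-point extension of `σ`, and the
heights at which the small values of `σ` split into a skew sum. -/
structure Represents {n : ℕ} (c : List ℕ) (σ : Equiv.Perm (Fin n)) : Prop where
  size_le : stackSize c ≤ n
  below_iff : ∀ j ≤ n, Avoids213Below σ j ↔ j ≤ stackSize c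
  of_isCut : ∀ i, IsCut c i → ∀ x y : Fin n, i ≤ (σ y : ℕ) → (σ y : ℕ) < stackSize c →
    (σ x : ℕ) < i → y < x
  of_not_isCut : ∀ i < stackSize c, ¬ IsCut c i →
    ∃ x y : Fin n, (σ y : ℕ) = i ∧ (σ x : ℕ) < i ∧ x < y

theorem represents_nil (σ : Equiv.Perm (Fin 0)) : Represents [] σ where
  size_le := le_rfl
  below_iff j hj := by
    simp only [stackSize, hj, iff_true]
    exact fun a => a.elim0
  of_isCut _ _ x := x.elim0
  of_not_isCut i hi := absurd hi (Nat.not_lt_zero i)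

theorem Represents.consPerm {n : ℕ} {c : List ℕ} {σ : Equiv.Perm (Fin n)} (h : Represents c σ)
    (v : Fin (n + 1)) (hvc : (v : ℕ) ≤ stackSize c) :
    Represents (stackInsert c v) (consPerm v σ) := by
  have hv := consPerm_succ_val v σ
  have h0 : (_root_.consPerm v σ 0 : ℕ) = v := by rw [consPerm_zero]
  have hn := h.size_le
  have hpos (x : Fin (n + 1)) (hx : (_root_.consPerm v σ x : ℕ) ≠ v) :
      ∃ x' : Fin n, x = x'.succ := by
    cases x using Fin.cases with
    | zero => exact absurd h0 hx
    | succ x => exact ⟨x, rfl⟩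
  have hlift (k : ℕ) (hk : k < v) (hc : ¬ IsCut c k) : ∃ x y : Fin (n + 1),
      (_root_.consPerm v σ y : ℕ) = k ∧ (_root_.consPerm v σ x : ℕ) < k ∧ x < y := by
    obtain ⟨x, y, h1, h2, h3⟩ := h.of_not_isCut k (by omega) hc
    refine ⟨x.succ, y.succ, ?_, ?_, by simpa⟩
    · rw [hv, if_pos (by omega), h1]
    · rwa [hv, if_pos (by omega)]
  by_cases hcut : IsCut c v
  · have hsize := stackSize_stackInsert_of_isCut hvc hcut
    have hcuts := isCut_stackInsert_of_isCut hvc hcut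
    refine ⟨by omega, fun j hj => ?_, fun k hk x y h1 h2 h3 => ?_, fun k hk hk' => ?_⟩
    · rw [hsize]
      constructor
      · intro hA
        by_contra! hlt
        have := (h.below_iff (j - 1) (by omega)).not.2 (by omega)
        refine this fun a b d hab hbd h1 h2 h3 => ?_
        refine hA a.succ b.succ d.succ (by simpa) (by simpa) ?_ ?_ ?_
        · rw [Fin.lt_def] at h1 ⊢
          rw [hv, hv]
          split_ifs <;> omega
        · rw [Fin.lt_def] at h2 ⊢
          rw [hv, hv]
          split_ifs <;> omega
        · rw [hv]
          split_ifs <;> omega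
      · intro hj' a b d hab hbd h1 h2 h3
        obtain ⟨b, rfl⟩ := Fin.exists_succ_eq.2 (ne_of_gt (lt_of_le_of_lt (Fin.zero_le a) hab))
        obtain ⟨d, rfl⟩ := Fin.exists_succ_eq.2 (ne_of_gt (lt_of_le_of_lt (Fin.zero_le _) hbd))
        rw [Fin.succ_lt_succ_iff] at hbd
        rw [Fin.lt_def] at h1 h2
        cases a using Fin.cases with
        | zero =>
          have hlt : d < b := by
            refine h.of_isCut v hcut b d ?_ ?_ ?_
            · rw [h0, hv] at h2
              split_ifs at h2 <;> omega
            · rw [hv] at h3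
              split_ifs at h3 <;> omega
            · rw [h0, hv] at h1
              split_ifs at h1 <;> omega
          exact absurd hlt (not_lt.2 hbd.le)
        | succ a =>
          refine (h.below_iff (stackSize c) hn).2 le_rfl a b d (by simpa using hab) hbd ?_ ?_ ?_
          · rw [hv, hv] at h1
            rw [Fin.lt_def]
            split_ifs at h1 <;> omega
          · rw [hv, hv] at h2
            rw [Fin.lt_def]
            split_ifs at h2 <;> omega
          · rw [hv] at h3
            split_ifs at h3 <;> omega
    · rw [hcuts] at hk
      rw [hsize] at h2
      rcases hk with ⟨hk, hkc⟩ | hk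
      · obtain ⟨x, rfl⟩ := hpos x (by omega)
        cases y using Fin.cases with
        | zero => exact Fin.succ_pos x
        | succ y =>
          rw [Fin.succ_lt_succ_iff]
          rw [hv] at h1 h2 h3
          refine h.of_isCut k hkc x y ?_ ?_ ?_
          · split_ifs at h1 <;> omega
          · split_ifs at h2 <;> omega
          · split_ifs at h3 <;> omega
      · omega
    · rw [hcuts] at hk'
      rw [hsize] at hk
      push Not at hk'
      rcases lt_trichotomy k v with hlt | rfl | hgt
      · exact hlift k hlt (hk'.1 hlt.le)
      · exact absurd hcut (hk'.1 le_rfl)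
      · obtain ⟨y, hy⟩ := (_root_.consPerm v σ).surjective ⟨k, by omega⟩
        rw [Fin.ext_iff] at hy
        obtain ⟨y, rfl⟩ := hpos y (by simp only at hy; omega)
        exact ⟨0, y.succ, hy, by omega, Fin.succ_pos y⟩
  · have hsize := stackSize_stackInsert_of_not_isCut hvc hcut
    have hcuts := isCut_stackInsert_of_not_isCut hvc hcut
    have hlt : (v : ℕ) < stackSize c := lt_of_le_of_ne hvc fun he => by
      rw [he] at hcut
      exact hcut (isCut_stackSize c)
    refine ⟨by omega, fun j hj => ?_, fun k hk x y h1 h2 h3 => ?_, fun k hk hk' => ?_⟩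
    · rw [hsize]
      constructor
      · intro hA
        by_contra! hj'
        obtain ⟨x, y, h1, h2, h3⟩ := h.of_not_isCut v hlt hcut
        refine hA 0 x.succ y.succ (Fin.succ_pos x) (by simpa) ?_ ?_ ?_
        · rw [Fin.lt_def, h0, hv, if_pos h2]
          exact h2
        · rw [Fin.lt_def, h0, hv, if_neg (by omega)]
          omega
        · rw [hv, if_neg (by omega)]
          omega
      · intro hj' a b d hab hbd h1 h2 h3
        obtain ⟨b, rfl⟩ := Fin.exists_succ_eq.2 (ne_of_gt (lt_of_le_of_lt (Fin.zero_le a) hab))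
        obtain ⟨d, rfl⟩ := Fin.exists_succ_eq.2 (ne_of_gt (lt_of_le_of_lt (Fin.zero_le _) hbd))
        rw [Fin.succ_lt_succ_iff] at hbd
        rw [Fin.lt_def] at h1 h2
        obtain ⟨a, rfl⟩ := hpos a (by omega)
        refine (h.below_iff v (by omega)).2 hvc a b d (by simpa using hab) hbd ?_ ?_ ?_
        · rw [hv, hv] at h1
          rw [Fin.lt_def]
          split_ifs at h1 <;> omega
        · rw [hv, hv] at h2
          rw [Fin.lt_def]
          split_ifs at h2 <;> omega
        · rw [hv] at h3
          split_ifs at h3 <;> omega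
    · rw [hcuts] at hk
      rw [hsize] at h2
      rcases hk with ⟨hk, hkc⟩ | hk | hk
      · obtain ⟨x, rfl⟩ := hpos x (by omega)
        cases y using Fin.cases with
        | zero => exact Fin.succ_pos x
        | succ y =>
          rw [Fin.succ_lt_succ_iff]
          rw [hv] at h1 h2 h3
          refine h.of_isCut k hkc x y ?_ ?_ ?_
          · split_ifs at h1 <;> omega
          · split_ifs at h2 <;> omega
          · split_ifs at h3 <;> omega
      · obtain ⟨x, rfl⟩ := hpos x (by omega)
        cases y using Fin.cases with
        | zero => exact Fin.succ_pos x
        | succ y =>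
          rw [hv] at h1 h2
          split_ifs at h1 h2 <;> omega
      · omega
    · rw [hcuts] at hk'
      rw [hsize] at hk
      push Not at hk'
      exact hlift k (by omega) (hk'.1 (by omega))

/-- The stack obtained by reading `σ` from right to left. -/
noncomputable def stackOf : ∀ {n : ℕ}, Equiv.Perm (Fin n) → List ℕ
  | 0, _ => []
  | n + 1, σ => stackInsert (stackOf ((consPermEquiv n).symm σ).2) (σ 0)

theorem stackOf_consPerm {n : ℕ} (v : Fin (n + 1)) (σ : Equiv.Perm (Fin n)) :
    stackOf (consPerm v σ) = stackInsert (stackOf σ) v := by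
  have : (consPermEquiv n).symm (consPerm v σ) = (v, σ) :=
    (consPermEquiv n).symm_apply_apply (v, σ)
  rw [stackOf, this, consPerm_zero]

theorem represents_stackOf {n : ℕ} (σ : Equiv.Perm (Fin n)) (h : Avoids4213 σ) :
    Represents (stackOf σ) σ := by
  induction n with
  | zero => exact represents_nil σ
  | succ n ih =>
    obtain ⟨⟨v, τ⟩, rfl⟩ := (consPermEquiv n).surjective σ
    change Avoids4213 (consPerm v τ) at h
    change Represents (stackOf (consPerm v τ)) (consPerm v τ)
    rw [avoids4213_consPerm] at h
    rw [stackOf_consPerm]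
    have := ih τ h.1
    exact this.consPerm v ((this.below_iff v (by omega)).1 h.2)

open Classical in
theorem sum_avoids4213 (n : ℕ) (φ : List ℕ → ℝ) :
    ∑ σ : Equiv.Perm (Fin n), (if Avoids4213 σ then φ (stackOf σ) else 0) = stackTotal n φ := by
  induction n generalizing φ with
  | zero =>
    have (σ : Equiv.Perm (Fin 0)) : Avoids4213 σ := fun a => a.elim0
    simp [this, stackOf, stackTotal]
  | succ n ih =>
    rw [stackTotal, ← ih, ← (consPermEquiv n).sum_comp, Fintype.sum_prod_type_right]
    refine sum_congr rfl fun σ _ => ?_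
    change ∑ v, (if Avoids4213 (consPerm v σ) then φ (stackOf (consPerm v σ)) else 0) = _
    simp only [avoids4213_consPerm, stackOf_consPerm]
    split_ifs with h
    · have hr := represents_stackOf σ h
      have h1 (v : Fin (n + 1)) : Avoids213Below σ v ↔ (v : ℕ) ≤ stackSize (stackOf σ) :=
        hr.below_iff v (by omega)
      simp only [h, true_and, h1]
      rw [Fin.sum_univ_eq_sum_range (fun v => if v ≤ stackSize (stackOf σ) then
        φ (stackInsert (stackOf σ) v) else 0), stackSum, ← sum_filter]
      refine sum_congr ?_ fun _ _ => rfl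
      ext v
      have := hr.size_le
      simp only [mem_filter, mem_range]
      omega
    · simp [h]

/-- The pattern 1342. -/
def pat1342 : Equiv.Perm (Fin 4) :=
  ⟨![0, 2, 3, 1], ![0, 3, 1, 2], by decide, by decide⟩

theorem permAvoids_pat1342_iff {n : ℕ} (p : Equiv.Perm (Fin n)) :
    PermAvoids p pat1342 ↔ ∀ a b c d : Fin n, a < b → b < c → c < d →
      p a < p d → p d < p b → ¬ p b < p c := by
  constructor
  · intro h a b c d hab hbc hcd h1 h2 h3
    refine h ⟨![a, b, c, d], ?_, ?_⟩
    · rw [Fin.strictMono_iff_lt_succ]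
      intro i
      fin_cases i <;> simpa
    · have e1 := h1.trans h2
      have e2 := e1.trans h3
      have e3 := h2.trans h3
      intro x y
      fin_cases x <;> fin_cases y <;>
        simp [pat1342, h1, h2, h3, e1, e2, e3, h1.le, h2.le, h3.le, e1.le, e2.le, e3.le]
  · rintro h ⟨f, hf, hp⟩
    refine h (f 0) (f 1) (f 2) (f 3) (hf (by decide)) (hf (by decide)) (hf (by decide)) ?_ ?_ ?_ <;>
    · rw [hp]
      decide

theorem avoiders_pat1342 (n : ℕ) : (avoiders n pat1342 : ℝ) = stackTotal n fun _ => 1 := by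
  classical
  rw [← sum_avoids4213, sum_boole, ← Fintype.card_subtype, avoiders, Nat.card_eq_fintype_card]
  congr 1
  refine Fintype.card_congr (Equiv.subtypeEquiv (Equiv.mulLeft Fin.revPerm) fun p => ?_)
  rw [permAvoids_pat1342_iff, Avoids4213]
  simp only [Equiv.coe_mulLeft, Equiv.Perm.mul_apply, Fin.revPerm_apply, Fin.rev_lt_rev]
  constructor
  · intro h a b c d hab hbc hcd h1 h2 h3
    exact h a b c d hab hbc hcd h3 h2 h1
  · intro h a b c d hab hbc hcd h1 h2 h3
    exact h a b c d hab hbc hcd h3 h2 h1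

theorem permAvoids_pat12453_iff {n : ℕ} (p : Equiv.Perm (Fin n)) :
    PermAvoids p pat12453 ↔ ∀ a b c d e : Fin n, a < b → b < c → c < d → d < e →
      p a < p b → p b < p e → p e < p c → ¬ p c < p d := by
  constructor
  · intro h a b c d e hab hbc hcd hde h1 h2 h3 h4
    refine h ⟨![a, b, c, d, e], ?_, ?_⟩
    · rw [Fin.strictMono_iff_lt_succ]
      intro i
      fin_cases i <;> simpa
    · have e1 := h1.trans h2
      have e2 := e1.trans h3
      have e3 := e2.trans h4
      have e4 := h2.trans h3
      have e5 := e4.trans h4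
      have e6 := h3.trans h4
      intro x y
      fin_cases x <;> fin_cases y <;>
        simp [pat12453, h1, h2, h3, h4, e1, e2, e3, e4, e5, e6, h1.le, h2.le, h3.le, h4.le, e1.le,
          e2.le, e3.le, e4.le, e5.le, e6.le]
  · rintro h ⟨f, hf, hp⟩
    refine h (f 0) (f 1) (f 2) (f 3) (f 4) (hf (by decide)) (hf (by decide)) (hf (by decide))
      (hf (by decide)) ?_ ?_ ?_ ?_ <;>
    · rw [hp]
      decide

/-- The entry of `p` at position `x` is a left-to-right minimum. -/
def IsLeftMin {n : ℕ} (p : Equiv.Perm (Fin n)) (x : Fin n) : Prop :=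
  ∀ y, y < x → p x < p y

theorem exists_isLeftMin_lt {n : ℕ} {p : Equiv.Perm (Fin n)} {x : Fin n} (hx : ¬ IsLeftMin p x) :
    ∃ y < x, IsLeftMin p y ∧ p y < p x := by
  obtain ⟨y, hy, hmin⟩ := (Finset.Iic x).exists_min_image p ⟨x, by simp⟩
  have hy' : IsLeftMin p y := fun z hz => lt_of_le_of_ne
    (hmin z (mem_Iic.2 (hz.le.trans (mem_Iic.1 hy)))) fun h => hz.ne' (p.injective h)
  have hne : y ≠ x := by
    rintro rfl
    exact hx hy'
  exact ⟨y, lt_of_le_of_ne (mem_Iic.1 hy) hne, hy', lt_of_le_of_ne (hmin x (by simp))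
    fun h => hne (p.injective h)⟩

open Classical in
/-- The positions of the left-to-right minima of `p`. -/
noncomputable def leftMins {n : ℕ} (p : Equiv.Perm (Fin n)) : Finset (Fin n) :=
  {x | IsLeftMin p x}

theorem mem_leftMins {n : ℕ} {p : Equiv.Perm (Fin n)} {x : Fin n} :
    x ∈ leftMins p ↔ IsLeftMin p x := by
  simp [leftMins]

theorem Fin.perm_eq_revPerm_of_strictAnti {k : ℕ} {q : Equiv.Perm (Fin k)} (h : StrictAnti q) :
    q = Fin.revPerm := by
  have h1 : StrictMono fun i => Fin.rev (q i) := fun i j hij => Fin.rev_lt_rev.2 (h hij)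
  have h2 : (fun i => Fin.rev (q i)) = id := by
    refine (StrictMono.range_inj h1 strictMono_id).1 ?_
    rw [Set.range_id]
    exact Function.Surjective.range_eq (Fin.rev_surjective.comp q.surjective)
  ext i
  have := congrFun h2 i
  simp only [id] at this
  rw [Fin.revPerm_apply, ← Fin.rev_rev (q i), this]

open Classical in
theorem card_avoids_leftMins_le {n : ℕ} (P V : Finset (Fin n)) (hPV : #P = #V) :
    #{p : Equiv.Perm (Fin n) | PermAvoids p pat12453 ∧ leftMins p = P ∧
      P.map p.toEmbedding = V} ≤ avoiders (n - #P) pat1342 := by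
  have hPc : #Pᶜ = n - #P := by simp [card_compl]
  have hVc : #Vᶜ = n - #P := by simp [card_compl, hPV]
  set α := finSumEquivOfFinset rfl hPc with hα
  set β := finSumEquivOfFinset hPV.symm hVc with hβ
  have hαl (i) : α (Sum.inl i) = P.orderEmbOfFin rfl i := finSumEquivOfFinset_inl _ _ i
  have hαr (i) : α (Sum.inr i) = Pᶜ.orderEmbOfFin hPc i := finSumEquivOfFinset_inr _ _ i
  have hβl (i) : β (Sum.inl i) = V.orderEmbOfFin hPV.symm i := finSumEquivOfFinset_inl _ _ i
  have hβr (i) : β (Sum.inr i) = Vᶜ.orderEmbOfFin hVc i := finSumEquivOfFinset_inr _ _ i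
  have hB : avoiders (n - #P) pat1342 =
      #{r : Equiv.Perm (Fin (n - #P)) | PermAvoids r pat1342} := by
    rw [avoiders, Nat.card_eq_fintype_card, Fintype.card_subtype]
  rw [hB]
  refine (card_le_card ?_).trans (card_image_le
    (f := fun r => α.symm.trans ((Equiv.sumCongr Fin.revPerm r).trans β)))
  intro p hp
  simp only [mem_filter, mem_univ, true_and, mem_image] at hp ⊢
  obtain ⟨hav, hmin, himg⟩ := hp
  set q : Equiv.Perm (Fin (#P) ⊕ Fin (n - #P)) := α.trans (p.trans β.symm) with hq
  have hqβ (x) : β (q x) = p (α x) := by simp [hq]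
  have hq_maps : Set.MapsTo q (Set.range Sum.inl) (Set.range Sum.inl) := by
    rintro _ ⟨i, rfl⟩
    have h1 : β (q (Sum.inl i)) ∈ V := by
      rw [hqβ, hαl, ← himg]
      exact mem_map_of_mem _ (orderEmbOfFin_mem _ _ _)
    rcases hj : q (Sum.inl i) with j | j
    · exact ⟨j, rfl⟩
    · rw [hj, hβr] at h1
      exact absurd h1 (mem_compl.1 (orderEmbOfFin_mem _ hVc j))
  obtain ⟨⟨q₁, q₂⟩, hq12⟩ := Equiv.Perm.mem_sumCongrHom_range_of_perm_mapsTo_inl hq_maps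
  change Equiv.sumCongr q₁ q₂ = q at hq12
  have hl (i) : β (Sum.inl (q₁ i)) = p (α (Sum.inl i)) := by rw [← hqβ, ← hq12]; rfl
  have hr (i) : β (Sum.inr (q₂ i)) = p (α (Sum.inr i)) := by rw [← hqβ, ← hq12]; rfl
  have hq₁ : q₁ = Fin.revPerm := by
    refine Fin.perm_eq_revPerm_of_strictAnti fun i j hij => ?_
    have h1 : IsLeftMin p (α (Sum.inl j)) := by
      rw [← mem_leftMins, hmin, hαl]
      exact orderEmbOfFin_mem _ _ _
    have h2 := h1 (α (Sum.inl i)) (by rw [hαl, hαl]; simpa using hij)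
    rw [← hl, ← hl, hβl, hβl] at h2
    simpa using h2
  refine ⟨q₂, ?_, ?_⟩
  · rw [permAvoids_pat12453_iff] at hav
    rw [permAvoids_pat1342_iff]
    intro a b c d hab hbc hcd h1 h2 h3
    have hα_lt {i j} (h : i < j) : α (Sum.inr i) < α (Sum.inr j) := by
      rw [hαr, hαr]
      simpa using h
    have hp_lt {i j} (h : q₂ i < q₂ j) : p (α (Sum.inr i)) < p (α (Sum.inr j)) := by
      rw [← hr, ← hr, hβr, hβr]
      simpa using h
    have ha : ¬ IsLeftMin p (α (Sum.inr a)) := by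
      rw [← mem_leftMins, hmin, hαr]
      exact mem_compl.1 (orderEmbOfFin_mem _ hPc a)
    obtain ⟨y, hy, -, hpy⟩ := exists_isLeftMin_lt ha
    exact hav y _ _ _ _ hy (hα_lt hab) (hα_lt hbc) (hα_lt hcd) hpy (hp_lt h1) (hp_lt h2) (hp_lt h3)
  · rw [← hq₁, hq12, hq]
    ext x
    simp

theorem avoiders_pat12453_le {A : ℝ} (hA : ∀ n, (avoiders n pat1342 : ℝ) ≤ A * 8 ^ n) (n : ℕ) :
    (avoiders n pat12453 : ℝ) ≤ A * ((1 + √8) ^ 2) ^ n := by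
  classical
  have hA0 : 0 ≤ A := by simpa using (Nat.cast_nonneg _).trans (hA 0)
  have h1 : avoiders n pat12453 = ∑ x : Finset (Fin n) × Finset (Fin n),
      #{p : Equiv.Perm (Fin n) | PermAvoids p pat12453 ∧ leftMins p = x.1 ∧
        x.1.map p.toEmbedding = x.2} := by
    rw [avoiders, Nat.card_eq_fintype_card, Fintype.card_subtype,
      card_eq_sum_card_fiberwise (t := univ)
        (f := fun p => (leftMins p, (leftMins p).map p.toEmbedding)) (fun _ _ => by simp)]
    refine sum_congr rfl fun x _ => ?_
    rw [filter_filter]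
    congr 1
    ext p
    simp only [mem_filter, mem_univ, true_and, Prod.ext_iff]
    refine and_congr_right fun _ => and_congr_right fun h => ?_
    rw [h]
  have h2 (x : Finset (Fin n) × Finset (Fin n)) :
      (#{p : Equiv.Perm (Fin n) | PermAvoids p pat12453 ∧ leftMins p = x.1 ∧
        x.1.map p.toEmbedding = x.2} : ℝ) ≤
      A * ((1 ^ #x.1 * √8 ^ (n - #x.1)) * (1 ^ #x.2 * √8 ^ (n - #x.2))) := by
    by_cases h : #x.1 = #x.2
    · calc _ ≤ (avoiders (n - #x.1) pat1342 : ℝ) := by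
            exact_mod_cast card_avoids_leftMins_le x.1 x.2 h
        _ ≤ A * 8 ^ (n - #x.1) := hA _
        _ = _ := by
          rw [← h, one_pow, one_mul, ← mul_pow, Real.mul_self_sqrt (by norm_num)]
    · rw [card_eq_zero.2, Nat.cast_zero]
      · positivity
      · refine filter_eq_empty_iff.2 fun p _ hp => h ?_
        rw [← hp.2.2, card_map]
  rw [h1, Nat.cast_sum]
  refine (sum_le_sum fun x _ => h2 x).trans_eq ?_
  rw [← mul_sum, Fintype.sum_prod_type]
  simp only
  rw [← sum_mul_sum]
  have h3 := Fintype.sum_pow_mul_eq_add_pow (Fin n) 1 √8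
  rw [Fintype.card_fin] at h3
  rw [h3, ← pow_two, ← pow_mul, ← pow_mul, mul_comm 2]

/-- Split an interval of length `c + m * N` into an initial part of length `c`, followed by `m`
blocks of length `N`. -/
def blocksEquiv (c m N : ℕ) : Fin c ⊕ (Fin m × Fin N) ≃ Fin (c + m * N) :=
  (Equiv.sumCongr (Equiv.refl _) finProdFinEquiv).trans finSumFinEquiv

theorem blocksEquiv_inl_val {c m N : ℕ} (i : Fin c) :
    (blocksEquiv c m N (Sum.inl i) : ℕ) = i := by
  simp [blocksEquiv]

theorem blocksEquiv_inr_val {c m N : ℕ} (t : Fin m) (i : Fin N) :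
    (blocksEquiv c m N (Sum.inr (t, i)) : ℕ) = c + t * N + i := by
  simp [blocksEquiv]
  ring

theorem block_lt_iff {N t t' i : ℕ} (hi : i < N) : t' * N + i < t * N ↔ t' < t := by
  constructor
  · intro h
    by_contra! h1
    have := Nat.mul_le_mul_right N h1
    omega
  · intro h
    have := Nat.mul_le_mul_right N (Nat.succ_le_of_lt h)
    rw [Nat.succ_mul] at this
    omega

section Split

variable {c m k s N : ℕ}

/-- Given a splitting of each of the `m` blocks of length `N` into `k` selected and `s` other
elements, split the whole interval of length `c + m * N` accordingly, selecting also the initial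
part of length `c`. -/
def splitEquiv (c : ℕ) (g : Fin m → Fin k ⊕ Fin s ≃ Fin N) :
    Fin (c + m * k) ⊕ (Fin m × Fin s) ≃ Fin (c + m * N) :=
  ((Equiv.sumCongr (blocksEquiv c m k).symm (Equiv.refl _)).trans (Equiv.sumAssoc _ _ _)).trans
    ((Equiv.sumCongr (Equiv.refl _)
      ((Equiv.prodSumDistrib _ _ _).symm.trans (Equiv.prodCongrRight g))).trans
        (blocksEquiv c m N))

theorem splitEquiv_inl_inl (g : Fin m → Fin k ⊕ Fin s ≃ Fin N) (i : Fin c) :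
    splitEquiv c g (Sum.inl (blocksEquiv c m k (Sum.inl i))) = blocksEquiv c m N (Sum.inl i) := by
  simp [splitEquiv]

theorem splitEquiv_inl_inr (g : Fin m → Fin k ⊕ Fin s ≃ Fin N) (t : Fin m) (i : Fin k) :
    splitEquiv c g (Sum.inl (blocksEquiv c m k (Sum.inr (t, i)))) =
      blocksEquiv c m N (Sum.inr (t, g t (Sum.inl i))) := by
  simp [splitEquiv]

theorem splitEquiv_inr (g : Fin m → Fin k ⊕ Fin s ≃ Fin N) (t : Fin m) (i : Fin s) :
    splitEquiv c g (Sum.inr (t, i)) = blocksEquiv c m N (Sum.inr (t, g t (Sum.inr i))) := by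
  simp [splitEquiv]

theorem splitEquiv_inl_lt_iff (g : Fin m → Fin k ⊕ Fin s ≃ Fin N) (d : Fin (c + m * k)) (t : ℕ) :
    (splitEquiv c g (Sum.inl d) : ℕ) < c + t * N ↔ (d : ℕ) < c + t * k := by
  obtain ⟨x, rfl⟩ := (blocksEquiv c m k).surjective d
  rcases x with i | ⟨t', i⟩
  · rw [splitEquiv_inl_inl, blocksEquiv_inl_val, blocksEquiv_inl_val]
    omega
  · rw [splitEquiv_inl_inr, blocksEquiv_inr_val, blocksEquiv_inr_val, add_assoc, add_assoc,
      Nat.add_lt_add_iff_left, Nat.add_lt_add_iff_left, block_lt_iff (Fin.is_lt _),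
      block_lt_iff (Fin.is_lt _)]

theorem le_splitEquiv_inr (g : Fin m → Fin k ⊕ Fin s ≃ Fin N) (t : Fin m) (i : Fin s) :
    c + t * N ≤ splitEquiv c g (Sum.inr (t, i)) := by
  rw [splitEquiv_inr, blocksEquiv_inr_val]
  omega

theorem splitEquiv_inl_strictMono {g : Fin m → Fin k ⊕ Fin s ≃ Fin N}
    (hg : ∀ t, StrictMono fun i => g t (Sum.inl i)) :
    StrictMono fun d => splitEquiv c g (Sum.inl d) := by
  intro d d' h
  obtain ⟨x, rfl⟩ := (blocksEquiv c m k).surjective d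
  obtain ⟨y, rfl⟩ := (blocksEquiv c m k).surjective d'
  rcases x with i | ⟨t, i⟩ <;> rcases y with j | ⟨t', j⟩ <;>
    simp only [Fin.lt_def, splitEquiv_inl_inl, splitEquiv_inl_inr, blocksEquiv_inl_val,
      blocksEquiv_inr_val] at h ⊢
  · exact h
  · omega
  · omega
  · rcases lt_trichotomy t t' with h1 | rfl | h1
    · have := (block_lt_iff (g t (Sum.inl i)).is_lt).2 h1
      omega
    · have := hg t (show i < j by rw [Fin.lt_def]; omega)
      simp only [Fin.lt_def] at this
      omega
    · have := (block_lt_iff j.is_lt).2 h1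
      omega

theorem splitEquiv_inr_lt {g : Fin m → Fin k ⊕ Fin s ≃ Fin N}
    (hg : ∀ t, StrictMono fun i => g t (Sum.inr i)) {t t' : Fin m} {i j : Fin s}
    (h : splitEquiv c g (Sum.inr (t, i)) < splitEquiv c g (Sum.inr (t', j))) :
    t < t' ∨ t = t' ∧ i < j := by
  simp only [Fin.lt_def, splitEquiv_inr, blocksEquiv_inr_val] at h
  rcases lt_trichotomy t t' with h1 | rfl | h1
  · exact Or.inl h1
  · refine Or.inr ⟨rfl, (hg t).lt_iff_lt.1 ?_⟩
    rw [Fin.lt_def]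
    omega
  · have := (block_lt_iff (g t' (Sum.inr j)).is_lt).2 h1
    omega

/-- The skew sum of the permutations `ρ 0, …, ρ (m - 1)`. -/
def skewSum (ρ : Fin m → Equiv.Perm (Fin s)) : Equiv.Perm (Fin m × Fin s) :=
  (Equiv.prodCongrRight ρ).trans (Equiv.prodCongr Fin.revPerm (Equiv.refl _))

/-- The permutation whose selected entries form a decreasing sequence, and whose other entries
form the skew sum of the permutations `ρ t`. -/
def mergePerm (c : ℕ) (g h : Fin m → Fin k ⊕ Fin s ≃ Fin N) (ρ : Fin m → Equiv.Perm (Fin s)) :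
    Equiv.Perm (Fin (c + m * N)) :=
  (splitEquiv c g).symm.trans
    ((Equiv.sumCongr Fin.revPerm (skewSum ρ)).trans (splitEquiv c h))

variable {g h : Fin m → Fin k ⊕ Fin s ≃ Fin N} {ρ : Fin m → Equiv.Perm (Fin s)}

theorem mergePerm_inl (d : Fin (c + m * k)) :
    mergePerm c g h ρ (splitEquiv c g (Sum.inl d)) = splitEquiv c h (Sum.inl d.rev) := by
  simp [mergePerm]

theorem mergePerm_inr (t : Fin m) (i : Fin s) :
    mergePerm c g h ρ (splitEquiv c g (Sum.inr (t, i))) =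
      splitEquiv c h (Sum.inr (t.rev, ρ t i)) := by
  simp [mergePerm, skewSum]

theorem isLeftMin_mergePerm_inl (hg : ∀ t, StrictMono fun i => g t (Sum.inl i))
    (hh : ∀ t, StrictMono fun i => h t (Sum.inl i)) (hc : k ≤ c) (d : Fin (c + m * k)) :
    IsLeftMin (mergePerm c g h ρ) (splitEquiv c g (Sum.inl d)) := by
  intro y hy
  obtain ⟨x, rfl⟩ := (splitEquiv c g).surjective y
  rcases x with d' | ⟨t, j⟩
  · rw [mergePerm_inl, mergePerm_inl]
    refine splitEquiv_inl_strictMono hh (Fin.rev_lt_rev.2 ?_)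
    exact (splitEquiv_inl_strictMono hg).lt_iff_lt.1 hy
  · rw [mergePerm_inl, mergePerm_inr, Fin.lt_def]
    rw [Fin.lt_def] at hy
    have h1 := le_splitEquiv_inr (c := c) g t j
    have h2 := (splitEquiv_inl_lt_iff g d t).not.1 (by omega)
    have h3 : m * k = t * k + t.rev * k + k := by
      have : m = t + t.rev + 1 := by
        rw [Fin.val_rev]
        omega
      calc m * k = (t + t.rev + 1) * k := by rw [← this]
        _ = _ := by ring
    have h4 := (splitEquiv_inl_lt_iff h d.rev t.rev).2 (by rw [Fin.val_rev d]; omega)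
    exact h4.trans_le (le_splitEquiv_inr h _ _)

theorem not_isLeftMin_mergePerm_inr (hc : k < c) (t : Fin m) (j : Fin s) :
    ¬ IsLeftMin (mergePerm c g h ρ) (splitEquiv c g (Sum.inr (t, j))) := by
  intro hmin
  have h3 : m * k = t * k + t.rev * k + k := by
    have : m = t + t.rev + 1 := by
      rw [Fin.val_rev]
      omega
    calc m * k = (t + t.rev + 1) * k := by rw [← this]
      _ = _ := by ring
  set d : Fin (c + m * k) := ⟨t * k + k, by omega⟩ with hd
  have h1 := (splitEquiv_inl_lt_iff g d t).2 (by rw [hd]; simp only; omega)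
  have h2 := (splitEquiv_inl_lt_iff h d.rev t.rev).2 (by
    rw [Fin.val_rev d, hd]
    simp only
    omega)
  have h4 := hmin _ (Fin.lt_def.2 (h1.trans_le (le_splitEquiv_inr g t j)))
  rw [mergePerm_inl, mergePerm_inr, Fin.lt_def] at h4
  have h5 := le_splitEquiv_inr (c := c) h t.rev (ρ t j)
  omega

theorem permAvoids_mergePerm (hg : ∀ t, StrictMono fun i => g t (Sum.inl i))
    (hg' : ∀ t, StrictMono fun i => g t (Sum.inr i))
    (hh : ∀ t, StrictMono fun i => h t (Sum.inl i))
    (hh' : ∀ t, StrictMono fun i => h t (Sum.inr i)) (hc : k < c)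
    (hρ : ∀ t, PermAvoids (ρ t) pat1342) : PermAvoids (mergePerm c g h ρ) pat12453 := by
  rw [permAvoids_pat12453_iff]
  intro a x₁ x₂ x₃ x₄ h01 h12 h23 h34 hv01 hv14 hv42 hv23
  have hmem (a x : Fin (c + m * N)) (hax : a < x)
      (hv : mergePerm c g h ρ a < mergePerm c g h ρ x) :
      ∃ t j, x = splitEquiv c g (Sum.inr (t, j)) := by
    obtain ⟨y, rfl⟩ := (splitEquiv c g).surjective x
    rcases y with d | ⟨t, j⟩
    · exact absurd hv (isLeftMin_mergePerm_inl hg hh hc.le d a hax).asymm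
    · exact ⟨t, j, rfl⟩
  have hsame {t t' : Fin m} {j j' : Fin s}
      (hlt : splitEquiv c g (Sum.inr (t, j)) < splitEquiv c g (Sum.inr (t', j')))
      (hv : mergePerm c g h ρ (splitEquiv c g (Sum.inr (t, j))) <
        mergePerm c g h ρ (splitEquiv c g (Sum.inr (t', j')))) : t = t' := by
    rw [mergePerm_inr, mergePerm_inr] at hv
    rcases splitEquiv_inr_lt hg' hlt with h1 | h1
    · rcases splitEquiv_inr_lt hh' hv with h2 | h2
      · exact absurd (Fin.rev_lt_rev.1 h2) h1.asymm
      · exact (Fin.rev_injective h2.1)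
    · exact h1.1
  have hpos {t : Fin m} {j j' : Fin s}
      (hlt : splitEquiv c g (Sum.inr (t, j)) < splitEquiv c g (Sum.inr (t, j'))) : j < j' :=
    (splitEquiv_inr_lt hg' hlt).resolve_left (lt_irrefl t) |>.2
  have hval {t : Fin m} {j j' : Fin s}
      (hv : mergePerm c g h ρ (splitEquiv c g (Sum.inr (t, j))) <
        mergePerm c g h ρ (splitEquiv c g (Sum.inr (t, j')))) : ρ t j < ρ t j' := by
    rw [mergePerm_inr, mergePerm_inr] at hv
    exact (splitEquiv_inr_lt hh' hv).resolve_left (lt_irrefl _) |>.2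
  obtain ⟨t₁, j₁, rfl⟩ := hmem a x₁ h01 hv01
  have hv12 := hv14.trans hv42
  obtain ⟨t₂, j₂, rfl⟩ := hmem _ x₂ h12 hv12
  obtain ⟨t₃, j₃, rfl⟩ := hmem _ x₃ h23 hv23
  obtain ⟨t₄, j₄, rfl⟩ := hmem _ x₄ ((h12.trans h23).trans h34) hv14
  obtain rfl := hsame h12 hv12
  obtain rfl := hsame h23 hv23
  obtain rfl := hsame ((h12.trans h23).trans h34) hv14
  exact (permAvoids_pat1342_iff _).1 (hρ t₁) j₁ j₂ j₃ j₄ (hpos h12) (hpos h23) (hpos h34)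
    (hval hv14) (hval hv42) (hval hv23)

end Split

/-- The selection of the elements of a `k`-element subset of an interval. -/
def selectEquiv {k s : ℕ} (F : {F : Finset (Fin (k + s)) // #F = k}) :
    Fin k ⊕ Fin s ≃ Fin (k + s) :=
  finSumEquivOfFinset F.2 (by simp [card_compl, F.2])

theorem selectEquiv_inl_strictMono {k s : ℕ} (F : {F : Finset (Fin (k + s)) // #F = k}) :
    StrictMono fun i => selectEquiv F (Sum.inl i) :=
  (F.1.orderEmbOfFin F.2).strictMono

theorem selectEquiv_inr_strictMono {k s : ℕ} (F : {F : Finset (Fin (k + s)) // #F = k}) :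
    StrictMono fun i => selectEquiv F (Sum.inr i) :=
  (F.1ᶜ.orderEmbOfFin (by simp [card_compl, F.2])).strictMono

theorem selectEquiv_mem_iff {k s : ℕ} (F : {F : Finset (Fin (k + s)) // #F = k})
    (x : Fin k ⊕ Fin s) : selectEquiv F x ∈ F.1 ↔ ∃ i, x = Sum.inl i := by
  rcases x with i | i
  · simp only [Sum.inl.injEq, exists_eq', iff_true]
    exact orderEmbOfFin_mem _ F.2 i
  · simp only [reduceCtorEq, exists_false, iff_false]
    exact mem_compl.1 (orderEmbOfFin_mem F.1ᶜ (by simp [card_compl, F.2]) i)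

section Count

variable {c m k s : ℕ}

theorem isLeftMin_mergePerm_iff (hc : k < c)
    (F G : Fin m → {F : Finset (Fin (k + s)) // #F = k}) (ρ : Fin m → Equiv.Perm (Fin s))
    (t : Fin m) (y : Fin (k + s)) :
    IsLeftMin (mergePerm c (fun t => selectEquiv (F t)) (fun t => selectEquiv (G t)) ρ)
      (blocksEquiv c m (k + s) (Sum.inr (t, y))) ↔ y ∈ (F t).1 := by
  obtain ⟨x, rfl⟩ := (selectEquiv (F t)).surjective y
  rw [selectEquiv_mem_iff]
  rcases x with i | i
  · rw [← splitEquiv_inl_inr (c := c) fun t => selectEquiv (F t)]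
    simp only [Sum.inl.injEq, exists_eq', iff_true]
    exact isLeftMin_mergePerm_inl (fun t => selectEquiv_inl_strictMono (F t))
      (fun t => selectEquiv_inl_strictMono (G t)) hc.le _
  · rw [← splitEquiv_inr (c := c) fun t => selectEquiv (F t)]
    simp only [reduceCtorEq, exists_false, iff_false]
    exact not_isLeftMin_mergePerm_inr hc _ _

theorem isLeftMin_mergePerm_symm_iff (hc : k < c)
    (F G : Fin m → {F : Finset (Fin (k + s)) // #F = k}) (ρ : Fin m → Equiv.Perm (Fin s))
    (t : Fin m) (y : Fin (k + s)) :
    IsLeftMin (mergePerm c (fun t => selectEquiv (F t)) (fun t => selectEquiv (G t)) ρ)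
      ((mergePerm c (fun t => selectEquiv (F t)) (fun t => selectEquiv (G t)) ρ).symm
        (blocksEquiv c m (k + s) (Sum.inr (t, y)))) ↔ y ∈ (G t).1 := by
  obtain ⟨x, rfl⟩ := (selectEquiv (G t)).surjective y
  rw [selectEquiv_mem_iff]
  rcases x with i | i
  · rw [← splitEquiv_inl_inr (c := c) fun t => selectEquiv (G t),
      ← Fin.rev_rev (blocksEquiv c m k _), ← mergePerm_inl (g := fun t => selectEquiv (F t))
        (ρ := ρ), Equiv.symm_apply_apply]
    simp only [Sum.inl.injEq, exists_eq', iff_true]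
    exact isLeftMin_mergePerm_inl (fun t => selectEquiv_inl_strictMono (F t))
      (fun t => selectEquiv_inl_strictMono (G t)) hc.le _
  · rw [← splitEquiv_inr (c := c) fun t => selectEquiv (G t),
      ← Fin.rev_rev t, ← (ρ t.rev).apply_symm_apply i,
      ← mergePerm_inr (g := fun t => selectEquiv (F t)), Equiv.symm_apply_apply]
    simp only [reduceCtorEq, exists_false, iff_false]
    exact not_isLeftMin_mergePerm_inr hc _ _

theorem mergePerm_injective (hc : k < c) : Function.Injective
    fun x : (Fin m → {F : Finset (Fin (k + s)) // #F = k}) ×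
        (Fin m → {F : Finset (Fin (k + s)) // #F = k}) × (Fin m → Equiv.Perm (Fin s)) =>
      mergePerm c (fun t => selectEquiv (x.1 t)) (fun t => selectEquiv (x.2.1 t)) x.2.2 := by
  rintro ⟨F, G, ρ⟩ ⟨F', G', ρ'⟩ h
  simp only at h
  have hF : F = F' := by
    ext t y
    rw [← isLeftMin_mergePerm_iff hc F G ρ, h, isLeftMin_mergePerm_iff hc]
  have hG : G = G' := by
    ext t y
    rw [← isLeftMin_mergePerm_symm_iff hc F G ρ, h, isLeftMin_mergePerm_symm_iff hc]
  subst hF hG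
  have hρ : ρ = ρ' := by
    ext t i
    have h1 := DFunLike.congr_fun h (splitEquiv c (fun t => selectEquiv (F t)) (Sum.inr (t, i)))
    rw [mergePerm_inr, mergePerm_inr] at h1
    have h2 := Sum.inr_injective ((splitEquiv c _).injective h1)
    exact congrArg Fin.val (Prod.ext_iff.1 h2).2
  rw [hρ]

theorem pow_le_avoiders_pat12453 (hc : k < c) :
    ((k + s).choose k ^ 2 * avoiders s pat1342) ^ m ≤ avoiders (c + m * (k + s)) pat12453 := by
  have h1 : Nat.card {F : Finset (Fin (k + s)) // #F = k} = (k + s).choose k := by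
    rw [Nat.card_eq_fintype_card, Fintype.card_finset_len, Fintype.card_fin]
  calc _ = Nat.card ((Fin m → {F : Finset (Fin (k + s)) // #F = k}) ×
        (Fin m → {F : Finset (Fin (k + s)) // #F = k}) ×
        (Fin m → {r : Equiv.Perm (Fin s) // PermAvoids r pat1342})) := by
        rw [Nat.card_prod, Nat.card_prod, Nat.card_fun, Nat.card_fun, h1, Nat.card_fin, avoiders]
        ring
    _ ≤ _ := by
      refine Nat.card_le_card_of_injective (fun x => ⟨mergePerm c (fun t => selectEquiv (x.1 t))
        (fun t => selectEquiv (x.2.1 t)) fun t => (x.2.2 t).1, permAvoids_mergePerm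
          (fun t => selectEquiv_inl_strictMono _) (fun t => selectEquiv_inr_strictMono _)
          (fun t => selectEquiv_inl_strictMono _) (fun t => selectEquiv_inr_strictMono _)
          hc fun t => (x.2.2 t).2⟩) ?_
      rintro ⟨F, G, ρ⟩ ⟨F', G', ρ'⟩ h
      have h2 := mergePerm_injective hc (a₁ := (F, G, fun t => (ρ t).1))
        (a₂ := (F', G', fun t => (ρ' t).1)) (Subtype.ext_iff.1 h)
      simp only [Prod.mk.injEq] at h2 ⊢
      exact ⟨h2.1, h2.2.1, funext fun t => Subtype.ext (congrFun h2.2.2 t)⟩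

end Count

theorem exists_pow_lt_avoiders {ν : ℝ} (h1 : √8 ≤ ν) (h2 : ν < 1 + √8) :
    ∃ k s : ℕ, (ν ^ 2) ^ (k + s) < ((k + s).choose k : ℝ) ^ 2 * avoiders s pat1342 := by
  by_contra! h
  have h8 : 1 < √8 := by
    rw [Real.lt_sqrt (by norm_num)]
    norm_num
  have hs8 : √8 ^ 2 = 8 := Real.sq_sqrt (by norm_num)
  have hν : 0 < ν := by linarith
  obtain ⟨y, hy1, hy2⟩ := exists_between (show max 0 (ν - √8) < 1 from
    max_lt zero_lt_one (by linarith))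
  obtain ⟨hy0, hy3⟩ := max_lt_iff.1 hy1
  set x := y / ν with hx
  have hνx : ν * x = y := by
    rw [hx]
    field_simp
  have hx0 : 0 < x := by positivity
  have hx1 : x < 1 := by
    rw [hx, div_lt_one hν]
    linarith
  have hB (s : ℕ) : √(avoiders s pat1342) * (1 / (1 - x) ^ (s + 1)) ≤ ν ^ s * (1 - y)⁻¹ := by
    refine hasSum_le (fun k => ?_) ((hasSum_choose_mul_geometric_of_norm_lt_one s
      (show ‖x‖ < 1 by rwa [Real.norm_of_nonneg hx0.le])).mul_left _)
      ((hasSum_geometric_of_lt_one hy0.le hy2).mul_left _)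
    have h3 : √(avoiders s pat1342) * (k + s).choose s ≤ ν ^ (k + s) := by
      rw [← abs_of_pos (pow_pos hν (k + s))]
      refine Real.le_sqrt_of_sq_le ?_ |>.trans_eq (Real.sqrt_sq_eq_abs _)
      rw [mul_pow, Real.sq_sqrt (Nat.cast_nonneg _), ← Nat.choose_symm_add, ← pow_mul,
        mul_comm (k + s), pow_mul, mul_comm]
      exact h k s
    calc √(avoiders s pat1342) * ((k + s).choose s * x ^ k)
        = √(avoiders s pat1342) * (k + s).choose s * x ^ k := by ring
      _ ≤ ν ^ (k + s) * x ^ k := by gcongr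
      _ = ν ^ s * y ^ k := by
        rw [← hνx]
        ring
  have hνy : 0 < ν - y := by linarith
  refine not_stackTotal_one_le (l := (ν - y) ^ 2) (by positivity) ?_
    (((1 - x) / (1 - y)) ^ 2) fun s => ?_
  · rw [← hs8]
    gcongr
    linarith
  · rw [← avoiders_pat1342, ← Real.sq_sqrt (Nat.cast_nonneg (avoiders s pat1342)), ← pow_mul,
      mul_comm 2, pow_mul, ← mul_pow]
    gcongr
    have h1x : 0 < 1 - x := by linarith
    have h1y : 0 < 1 - y := by linarith
    have h3 := hB s
    rw [mul_one_div, div_le_iff₀ (by positivity)] at h3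
    refine h3.trans_eq ?_
    have h4 : ν - y = ν * (1 - x) := by linear_combination hνx
    rw [h4, mul_pow, pow_succ']
    field_simp

theorem exists_mul_pow_le_avoiders {ν : ℝ} (h1 : √8 ≤ ν) (h2 : ν < 1 + √8) :
    ∃ D > 0, ∃ n₀, ∀ n ≥ n₀, D * (ν ^ 2) ^ n ≤ (avoiders n pat12453 : ℝ) := by
  obtain ⟨k, s, hks⟩ := exists_pow_lt_avoiders h1 h2
  have h8 : 1 < √8 := by
    rw [Real.lt_sqrt (by norm_num)]
    norm_num
  have hμ : 1 ≤ ν ^ 2 := one_le_pow₀ (by linarith)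
  have hμ0 : 0 < ν ^ 2 := by linarith
  have hN : 0 < k + s := by
    by_contra! h0
    obtain ⟨rfl, rfl⟩ : k = 0 ∧ s = 0 := by omega
    rw [avoiders_pat1342] at hks
    simp [stackTotal] at hks
  refine ⟨((ν ^ 2) ^ (k + 1 + (k + s)))⁻¹, by positivity, k + 1, fun n hn => ?_⟩
  set m := (n - (k + 1)) / (k + s)
  set c := k + 1 + (n - (k + 1)) % (k + s) with hc
  have hn' : n = c + m * (k + s) := by
    have : m * (k + s) + (n - (k + 1)) % (k + s) = n - (k + 1) := Nat.div_add_mod' _ _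
    omega
  have hc' : c ≤ k + 1 + (k + s) := by
    have := Nat.mod_lt (n - (k + 1)) hN
    omega
  have hle := pow_le_avoiders_pat12453 (c := c) (m := m) (k := k) (s := s) (by omega)
  rw [← hn'] at hle
  have hle' : (((k + s).choose k : ℝ) ^ 2 * avoiders s pat1342) ^ m ≤ avoiders n pat12453 := by
    exact_mod_cast hle
  refine le_trans ?_ hle'
  rw [inv_mul_le_iff₀ (by positivity)]
  calc (ν ^ 2) ^ n = (ν ^ 2) ^ c * ((ν ^ 2) ^ (k + s)) ^ m := by
        rw [hn', pow_add, mul_comm m, pow_mul]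
    _ ≤ _ := by gcongr

theorem tendsto_mul_pow_rpow {D a : ℝ} (hD : 0 < D) (ha : 0 ≤ a) :
    Filter.Tendsto (fun n : ℕ => (D * a ^ n) ^ (1 / (n : ℝ))) Filter.atTop (nhds a) := by
  have h1 : Filter.Tendsto (fun n : ℕ => D ^ (1 / (n : ℝ))) Filter.atTop (nhds 1) := by
    have := (Real.continuousAt_const_rpow (b := 0) hD.ne').tendsto.comp
      tendsto_one_div_atTop_nhds_zero_nat
    rwa [Real.rpow_zero] at this
  have h2 := h1.mul_const a
  rw [one_mul] at h2
  refine h2.congr' ?_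
  filter_upwards [Filter.eventually_ne_atTop 0] with n hn
  rw [Real.mul_rpow hD.le (by positivity), one_div, Real.pow_rpow_inv_natCast ha hn]

end

/-- `(S_n(12453))^{1/n}` converges to `(1 + √8)² = 9 + 4√2`. -/
theorem stanley_wilf_12453_limit :
    Filter.Tendsto (fun n : ℕ => (avoiders n pat12453 : ℝ) ^ (1 / (n : ℝ)))
      Filter.atTop (nhds ((1 + Real.sqrt 8) ^ 2)) := by
  refine tendsto_order.2 ⟨fun a ha => ?_, fun b hb => ?_⟩
  · obtain ⟨ν, hν, hν'⟩ := exists_between (show max √8 √a < 1 + √8 from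
      max_lt (by linarith) (Real.sqrt_lt' (by positivity) |>.2 ha))
    obtain ⟨hν8, hνa⟩ := max_lt_iff.1 hν
    have hν0 : 0 < ν := (Real.sqrt_nonneg 8).trans_lt hν8
    obtain ⟨D, hD, n₀, h⟩ := exists_mul_pow_le_avoiders hν8.le hν'
    filter_upwards [(tendsto_mul_pow_rpow hD (sq_nonneg ν)).eventually_const_lt
      ((Real.sqrt_lt' hν0).1 hνa), Filter.eventually_ge_atTop n₀] with n hn hn₀
    exact hn.trans_le (Real.rpow_le_rpow (by positivity) (h n hn₀) (by positivity))
  · obtain ⟨A, hA⟩ := stackTotal_one_le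
    have hA' (n : ℕ) : (avoiders n pat1342 : ℝ) ≤ max A 1 * 8 ^ n := by
      rw [avoiders_pat1342]
      exact (hA n).trans (mul_le_mul_of_nonneg_right (le_max_left A 1) (by positivity))
    filter_upwards [(tendsto_mul_pow_rpow (D := max A 1) (by positivity)
      (sq_nonneg (1 + √8))).eventually_lt_const hb] with n hn
    exact (Real.rpow_le_rpow (by positivity) (avoiders_pat12453_le hA' n)
      (by positivity)).trans_lt hn
end

section
/- Let q be a pattern of length k, and let q' be the pattern of length k+1 defined by q'(1) = 1 and q'(i+1) = q(i) + 1 for 1 ≤ i ≤ k. Let p be a permutation of length n and let S be the string of remaining entries of p. If S avoids q, then p avoids q'. -/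
/-- `p i` is a left-to-right minimum of `p`: every earlier entry is larger. -/
def IsLtrMin {n : ℕ} (p : Equiv.Perm (Fin n)) (i : Fin n) : Prop :=
  ∀ j : Fin n, j < i → p i < p j

/-- The sequence `s` contains the pattern `q` using only positions satisfying `P`:
there is a subsequence, supported on positions satisfying `P`, order-isomorphic to `q`.
Taking `P := fun _ => True` gives ordinary pattern containment in the sequence `s`;
taking `P i := ¬ IsLtrMin p i` and `s := p` gives pattern containment in the string
of remaining entries of a permutation `p`. -/
def ContainsOn {α : Type*} [LinearOrder α] {m k : ℕ} (s : Fin m → α)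
    (P : Fin m → Prop) (q : Equiv.Perm (Fin k)) : Prop :=
  ∃ f : Fin k → Fin m, StrictMono f ∧ (∀ a : Fin k, P (f a)) ∧
    ∀ a b : Fin k, s (f a) < s (f b) ↔ q a < q b

/-- A pattern `q` of length `k` is indecomposable if it cannot be cut into two parts
so that all entries before the cut are larger than all entries after the cut:
there is no `r` with `1 ≤ r < k` such that the first `r` positions carry exactly
the top `r` values `{k-r, …, k-1}` (0-indexed). -/
def Indecomposable {k : ℕ} (q : Equiv.Perm (Fin k)) : Prop :=
  ¬ ∃ r : ℕ, 1 ≤ r ∧ r < k ∧ ∀ i : Fin k, ((i : ℕ) < r ↔ k - r ≤ (q i : ℕ))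

/-- A pattern `q` is layered: positions can be labelled by a monotone block function `b`
(whose fibers are then consecutive intervals, the layers) such that `q` is decreasing
within each layer and entries in earlier layers are smaller than those in later layers,
i.e. for `i < j`, `q j < q i` exactly when `i` and `j` are in the same layer. -/
def Layered {k : ℕ} (q : Equiv.Perm (Fin k)) : Prop :=
  ∃ b : Fin k → ℕ, Monotone b ∧ ∀ i j : Fin k, i < j → (q j < q i ↔ b i = b j)

/-- If `q'` is obtained from `q` by adding 1 to each entry and prepending the entry 1,
and the string `S` of remaining entries of `p` avoids `q`, then `p` avoids `q'`. -/
theorem avoids_prepend_of_remaining_avoids {n k : ℕ}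
    (q : Equiv.Perm (Fin k)) (q' : Equiv.Perm (Fin (k + 1)))
    (hq'0 : q' 0 = 0) (hq' : ∀ i : Fin k, q' i.succ = (q i).succ)
    (p : Equiv.Perm (Fin n))
    (hS : ¬ ContainsOn (fun i => p i) (fun i => ¬ IsLtrMin p i) q) :
    PermAvoids p q' := by
  rintro ⟨f, hf, h⟩
  refine hS ⟨fun a => f a.succ, fun a b hab => hf (Fin.succ_lt_succ_iff.mpr hab),
    fun a hmin => ?_, fun a b => ?_⟩
  · have hlt : p (f 0) < p (f a.succ) := by
      rw [h, hq'0, hq']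
      exact Fin.succ_pos _
    exact lt_asymm hlt (hmin (f 0) (hf (Fin.succ_pos a)))
  · rw [h, hq', hq', Fin.succ_lt_succ_iff]
end

section
/- Let q be a pattern of length k that starts with 1 (i.e., q(1) = 1), and let q' be the pattern of length k+1 defined by q'(1) = 1 and q'(i+1) = q(i) + 1 for 1 ≤ i ≤ k. Let p be a permutation of length n and let S be the string of remaining entries of p. Then p avoids q' if and only if S avoids q. -/
/-- If `q` starts with its smallest entry and `q'` is obtained from `q` by adding 1 to
each entry and prepending the entry 1, then `p` avoids `q'` if and only if the string
`S` of remaining entries of `p` avoids `q`. -/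
theorem avoids_prepend_iff_remaining_avoids {n k : ℕ} (hk : 0 < k)
    (q : Equiv.Perm (Fin k)) (hq0 : (q ⟨0, hk⟩ : ℕ) = 0)
    (q' : Equiv.Perm (Fin (k + 1)))
    (hq'0 : q' 0 = 0) (hq' : ∀ i : Fin k, q' i.succ = (q i).succ)
    (p : Equiv.Perm (Fin n)) :
    PermAvoids p q' ↔ ¬ ContainsOn (fun i => p i) (fun i => ¬ IsLtrMin p i) q := by
  refine not_congr ⟨?_, ?_⟩
  · rintro ⟨g, hg, h⟩
    refine ⟨fun i => g i.succ, hg.comp (Fin.strictMono_succ), fun a hmin => ?_, fun a b => ?_⟩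
    · have hlt : p (g 0) < p (g a.succ) := by
        rw [h, hq'0, hq']
        exact Fin.succ_pos _
      exact lt_asymm hlt (hmin (g 0) (hg (Fin.succ_pos a)))
    · rw [h, hq', hq', Fin.succ_lt_succ_iff]
  · rintro ⟨f, hf, hP, h⟩
    obtain ⟨j, hj, hle⟩ : ∃ j, j < f ⟨0, hk⟩ ∧ p j ≤ p (f ⟨0, hk⟩) := by
      simpa [IsLtrMin] using hP ⟨0, hk⟩
    have hjlt : p j < p (f ⟨0, hk⟩) := lt_of_le_of_ne hle fun e => hj.ne (p.injective e)
    have hbelow (a : Fin k) : p j < p (f a) := by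
      refine hjlt.trans_le (not_lt.mp fun hlt => ?_)
      have := (h a ⟨0, hk⟩).mp hlt
      rw [Fin.lt_def, hq0] at this
      exact Nat.not_lt_zero _ this
    have hfirst (a : Fin k) : j < f a :=
      hj.trans_le (hf.monotone (Fin.mk_le_of_le_val (Nat.zero_le _)))
    refine ⟨Fin.cons j f, fun a b hab => ?_, fun a b => ?_⟩
    · cases a using Fin.cases with
      | zero =>
        cases b using Fin.cases with
        | zero => exact absurd hab (lt_irrefl _)
        | succ b => simpa using hfirst b
      | succ a =>
        cases b using Fin.cases with
        | zero => exact absurd hab (Fin.not_lt_zero _)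
        | succ b => simpa using hf (Fin.succ_lt_succ_iff.mp hab)
    · cases a using Fin.cases with
      | zero =>
        cases b using Fin.cases with
        | zero => simp
        | succ b => simpa [hq'0, hq', Fin.succ_pos] using hbelow b
      | succ a =>
        cases b using Fin.cases with
        | zero => simpa [hq'0, hq'] using (hbelow a).le
        | succ b => simpa [hq'] using h a b
end
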